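/- arXiv:2011.09942 — 3 statements merged into one kernel-verified Lean document; each statement's English description precedes it below -/
import Mathlib

section
/- Let μ be a finite positive Borel measure on ℝ that is even (invariant under t ↦ -t), has all moments finite, and satisfies the Carleman condition ∑_{m=1}^∞ M(2m)^{-1/(2m)} = ∞ where M(2m) = ∫ t^{2m} dμ. Then the even polynomials are dense in the subspace of even functions in L^1(ℝ, dμ). -/
open MeasureTheory

/-- **Carleman's inequality**, in its qualitative form. -/
theorem summable_geomMean_of_summable {a : ℕ → ℝ} (ha : ∀ n, 0 ≤ a n) (hs : Summable a) :
    Summable fun n : ℕ => (∏ i ∈ Finset.range (n + 1), a i) ^ (((n : ℝ) + 1)⁻¹) := by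
  set S : ℕ → ℝ := fun n => ∑ i ∈ Finset.range n, ((i : ℝ) + 1) * a i with hS
  have hS0 : ∀ n, 0 ≤ S n := fun n =>
    Finset.sum_nonneg fun i _ => mul_nonneg (by positivity) (ha i)
  have hSsucc : ∀ n, S (n + 1) = S n + ((n : ℝ) + 1) * a n := fun n => Finset.sum_range_succ _ _
  have hsum : Summable fun n : ℕ => S (n + 1) / ((n : ℝ) + 1) ^ 2 := by
    refine summable_of_sum_range_le (c := 2 * ∑' i, a i)
      (fun n => div_nonneg (hS0 _) (by positivity)) fun K => ?_
    have key : ∑ n ∈ Finset.range K, S (n + 1) / ((n : ℝ) + 1) ^ 2 + 2 * S K / (K + 1)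
        ≤ 2 * ∑ i ∈ Finset.range K, a i := by
      induction K with
      | zero => simp [hS]
      | succ K ih =>
        rw [Finset.sum_range_succ, Finset.sum_range_succ]
        have h1 : S (K + 1) / ((K : ℝ) + 1) ^ 2 + 2 * S (K + 1) / ((K + 1 : ℕ) + 1)
            ≤ 2 * S (K + 1) / (K + 1) := by
          have : 1 / ((K : ℝ) + 1) ^ 2 + 2 / ((K : ℝ) + 1 + 1) ≤ 2 / ((K : ℝ) + 1) := by
            rw [div_add_div _ _ (by positivity) (by positivity),
              div_le_div_iff₀ (by positivity) (by positivity)]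
            nlinarith [(Nat.cast_nonneg K : (0 : ℝ) ≤ K), pow_nonneg (Nat.cast_nonneg K : (0 : ℝ) ≤ K) 2]
          have := mul_le_mul_of_nonneg_left this (hS0 (K + 1))
          push_cast
          calc _ = S (K + 1) * (1 / ((K : ℝ) + 1) ^ 2 + 2 / ((K : ℝ) + 1 + 1)) := by ring
            _ ≤ _ := this
            _ = _ := by ring
        have h2 : 2 * S (K + 1) / ((K : ℝ) + 1) = 2 * S K / (K + 1) + 2 * a K := by
          rw [hSsucc]
          field_simp
        linarith
    have h3 := hs.sum_le_tsum (Finset.range K) fun i _ => ha i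
    have h4 : 0 ≤ 2 * S K / ((K : ℝ) + 1) := div_nonneg (by linarith [hS0 K]) (by positivity)
    linarith
  refine Summable.of_nonneg_of_le (fun n => Real.rpow_nonneg (Finset.prod_nonneg fun i _ => ha i) _)
    (fun n => ?_) (hsum.mul_left (Real.exp 1))
  have hn : (0 : ℝ) < (n : ℝ) + 1 := by positivity
  have amgm := Real.geom_mean_le_arith_mean_weighted (Finset.range (n + 1))
    (fun _ => ((n : ℝ) + 1)⁻¹) (fun i => ((i : ℝ) + 1) * a i) (fun _ _ => by positivity)
    (by simp [hn.ne']) (fun i _ => mul_nonneg (by positivity) (ha i))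
  rw [Real.finsetProd_rpow _ _ (fun i _ => mul_nonneg (by positivity) (ha i)),
    Finset.prod_mul_distrib, ← Finset.mul_sum,
    Real.mul_rpow (Finset.prod_nonneg fun i _ => by positivity)
      (Finset.prod_nonneg fun i _ => ha i)] at amgm
  have hfac : ((n : ℝ) + 1) / Real.exp 1 ≤
      (∏ i ∈ Finset.range (n + 1), ((i : ℝ) + 1)) ^ (((n : ℝ) + 1)⁻¹) := by
    have h1 : ∏ i ∈ Finset.range (n + 1), ((i : ℝ) + 1) = ((n + 1).factorial : ℝ) := by
      rw [← Finset.prod_range_add_one_eq_factorial]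
      push_cast
      rfl
    rw [h1, Real.le_rpow_inv_iff_of_pos (by positivity) (by positivity) hn]
    have h2 := Real.pow_div_factorial_le_exp ((n : ℝ) + 1) hn.le (n + 1)
    rw [div_le_iff₀ (by positivity)] at h2
    rw [Real.div_rpow hn.le (Real.exp_pos _).le, Real.exp_one_rpow,
      div_le_iff₀ (Real.exp_pos _), mul_comm]
    exact_mod_cast h2
  have hG : 0 ≤ (∏ i ∈ Finset.range (n + 1), a i) ^ (((n : ℝ) + 1)⁻¹) :=
    Real.rpow_nonneg (Finset.prod_nonneg fun i _ => ha i) _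
  have h5 := (mul_le_mul_of_nonneg_right hfac hG).trans amgm
  rw [div_mul_eq_mul_div, div_le_iff₀ (Real.exp_pos _)] at h5
  rw [← mul_div_assoc, le_div_iff₀ (by positivity)]
  have h6 := mul_le_mul_of_nonneg_left h5 hn.le
  calc _ = ((n : ℝ) + 1) * (((n : ℝ) + 1) * (∏ i ∈ Finset.range (n + 1), a i) ^ (((n : ℝ) + 1)⁻¹)) := by
        ring
    _ ≤ _ := h6
    _ = _ := by
        simp only [hS]
        field_simp

section Quasianalytic

variable {E : Type*} [NormedAddCommGroup E] [NormedSpace ℝ E] {f : ℕ → ℝ → E} {M : ℕ → ℝ}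

theorem norm_le_of_norm_le_at_left (hf : ∀ n x, HasDerivAt (f n) (f (n + 1) x) x)
    (hM : ∀ n, 0 < M n) (hfM : ∀ n x, ‖f n x‖ ≤ M n)
    (hmono : Monotone fun n => M (n + 1) / M n) {n : ℕ} {x y : ℝ} (hxy : x ≤ y)
    (hyx : y - x ≤ Real.exp (-1) * (M n / M (n + 1)))
    (hx : ∀ j, ‖f j x‖ ≤ Real.exp (j - (n + 1)) * M j) (j : ℕ) :
    ‖f j y‖ ≤ Real.exp (j - n) * M j := by
  set c := Real.exp 1 * (M (n + 1) / M n) with hc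
  have hc0 : 0 < c := mul_pos (Real.exp_pos _) (div_pos (hM _) (hM _))
  have main : ∀ k j, n + 1 ≤ j + k → ∀ z ∈ Set.Icc x y,
      ‖f j z‖ ≤ Real.exp (j - (n + 1)) * M j * Real.exp (c * (z - x)) := by
    intro k
    induction k with
    | zero =>
      intro j hj z hz
      have h1 : 1 ≤ Real.exp ((j : ℝ) - (n + 1)) := by
        rw [Real.one_le_exp_iff, sub_nonneg]
        exact_mod_cast hj
      have h2 : 1 ≤ Real.exp (c * (z - x)) := by
        rw [Real.one_le_exp_iff]
        exact mul_nonneg hc0.le (sub_nonneg.2 hz.1)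
      calc ‖f j z‖ ≤ M j := hfM j z
        _ ≤ Real.exp (j - (n + 1)) * M j := le_mul_of_one_le_left (hM j).le h1
        _ ≤ _ := le_mul_of_one_le_right (mul_nonneg (Real.exp_pos _).le (hM j).le) h2
    | succ k ih =>
      intro j hj z hz
      by_cases hjk : n + 1 ≤ j + k
      · exact ih j hjk z hz
      refine image_norm_le_of_norm_deriv_right_le_deriv_boundary (f := f j) (f' := f (j + 1))
        (B := fun z => Real.exp (j - (n + 1)) * M j * Real.exp (c * (z - x)))
        (B' := fun z => Real.exp (j - (n + 1)) * M j * (Real.exp (c * (z - x)) * c))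
        (fun w _ => (hf j w).continuousAt.continuousWithinAt)
        (fun w _ => (hf j w).hasDerivWithinAt) (by simpa using hx j) (fun w => ?_)
        (fun w hw => ?_) hz
      · have := ((hasDerivAt_id w).sub_const x).const_mul c
        simpa using (this.exp).const_mul (Real.exp (j - (n + 1)) * M j)
      · refine (ih (j + 1) (by omega) w (Set.Ico_subset_Icc_self hw)).trans ?_
        have h1 : M (j + 1) ≤ M (n + 1) / M n * M j := by
          rw [← div_le_iff₀ (hM j)]
          exact hmono (by omega : j ≤ n)
        have h2 : Real.exp (((j + 1 : ℕ) : ℝ) - (n + 1))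
            = Real.exp (j - (n + 1)) * Real.exp 1 := by
          rw [← Real.exp_add]
          push_cast
          ring_nf
        rw [h2]
        have h3 := mul_le_mul_of_nonneg_left h1 (mul_nonneg (mul_nonneg (Real.exp_pos
          ((j : ℝ) - (n + 1))).le (Real.exp_pos 1).le) (Real.exp_pos (c * (w - x))).le)
        calc _ = _ := by ring
          _ ≤ _ := h3
          _ = _ := by rw [hc]; ring
  refine (main (n + 1) j (by omega) y ⟨hxy, le_rfl⟩).trans ?_
  have h1 : c * (y - x) ≤ 1 := by
    calc c * (y - x) ≤ c * (Real.exp (-1) * (M n / M (n + 1))) :=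
          mul_le_mul_of_nonneg_left hyx hc0.le
      _ = 1 := by
        have := hM n
        have := hM (n + 1)
        rw [hc, Real.exp_neg]
        field_simp
  calc _ ≤ Real.exp (j - (n + 1)) * M j * Real.exp 1 :=
        mul_le_mul_of_nonneg_left (Real.exp_le_exp.2 h1) (mul_nonneg (Real.exp_pos _).le (hM j).le)
    _ = Real.exp (j - (n + 1)) * Real.exp 1 * M j := by ring
    _ = _ := by
      rw [← Real.exp_add]
      ring_nf

/-- The **Denjoy–Carleman theorem**, on the half-line. -/
theorem eq_zero_of_denjoyCarleman_of_nonneg (hf : ∀ n x, HasDerivAt (f n) (f (n + 1) x) x)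
    (hM : ∀ n, 0 < M n) (hfM : ∀ n x, ‖f n x‖ ≤ M n)
    (hmono : Monotone fun n => M (n + 1) / M n)
    (hdiv : ¬ Summable fun n => M n / M (n + 1)) (h0 : ∀ n, f n 0 = 0) {x : ℝ} (hx : 0 ≤ x) :
    f 0 x = 0 := by
  have step : ∀ m k : ℕ, ∀ y : ℝ, 0 ≤ y →
      y ≤ ∑ i ∈ Finset.range m, Real.exp (-1) * (M (k + i) / M (k + i + 1)) →
      ∀ j, ‖f j y‖ ≤ Real.exp (j - k) * M j := by
    intro m
    induction m with
    | zero =>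
      intro k y hy0 hy j
      obtain rfl : y = 0 := le_antisymm (by simpa using hy) hy0
      rw [h0, norm_zero]
      exact mul_nonneg (Real.exp_pos _).le (hM j).le
    | succ m ih =>
      intro k y hy0 hy j
      rw [Finset.sum_range_succ'] at hy
      have hpos : 0 ≤ Real.exp (-1) * (M k / M (k + 1)) :=
        mul_nonneg (Real.exp_pos _).le (div_pos (hM _) (hM _)).le
      refine norm_le_of_norm_le_at_left hf hM hfM hmono
        (x := max 0 (y - Real.exp (-1) * (M k / M (k + 1)))) (max_le hy0 (by linarith))
        (by linarith [le_max_right 0 (y - Real.exp (-1) * (M k / M (k + 1)))]) ?_ j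
      have := ih (k + 1) (max 0 (y - Real.exp (-1) * (M k / M (k + 1)))) (le_max_left _ _) ?_
      · exact_mod_cast this
      · refine max_le (Finset.sum_nonneg fun i _ => mul_nonneg (Real.exp_pos _).le
          (div_pos (hM _) (hM _)).le) ?_
        rw [sub_le_iff_le_add]
        refine hy.trans (le_of_eq ?_)
        simp only [add_zero, add_comm, add_left_comm]
  have hk : ∀ k : ℕ, ‖f 0 x‖ ≤ Real.exp (-(k : ℝ)) * M 0 := by
    intro k
    have hns : ¬ Summable fun i => Real.exp (-1) * (M (k + i) / M (k + i + 1)) := by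
      rw [summable_mul_left_iff (Real.exp_pos _).ne']
      intro h
      refine hdiv ((summable_nat_add_iff k).1 (h.congr fun i => ?_))
      rw [add_comm k i]
    rw [not_summable_iff_tendsto_nat_atTop_of_nonneg fun i => mul_nonneg (Real.exp_pos _).le
          (div_pos (hM _) (hM _)).le] at hns
    obtain ⟨m, hm⟩ := (hns.eventually_ge_atTop x).exists
    simpa using step m k x hx hm 0
  have hlim : Filter.Tendsto (fun k : ℕ => Real.exp (-(k : ℝ)) * M 0) Filter.atTop (nhds 0) := by
    simpa using (Real.tendsto_exp_neg_atTop_nhds_zero.comp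
      tendsto_natCast_atTop_atTop).mul_const (M 0)
  exact norm_le_zero_iff.1 (ge_of_tendsto' hlim hk)

/-- The **Denjoy–Carleman theorem**: a function whose successive derivatives are dominated by a
log-convex sequence `M` with `∑ M n / M (n + 1) = ∞` and all vanish at `0` is zero. -/
theorem eq_zero_of_denjoyCarleman (hf : ∀ n x, HasDerivAt (f n) (f (n + 1) x) x)
    (hM : ∀ n, 0 < M n) (hfM : ∀ n x, ‖f n x‖ ≤ M n)
    (hmono : Monotone fun n => M (n + 1) / M n)
    (hdiv : ¬ Summable fun n => M n / M (n + 1)) (h0 : ∀ n, f n 0 = 0) (x : ℝ) :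
    f 0 x = 0 := by
  rcases le_total 0 x with hx | hx
  · exact eq_zero_of_denjoyCarleman_of_nonneg hf hM hfM hmono hdiv h0 hx
  · have := eq_zero_of_denjoyCarleman_of_nonneg (f := fun n y => (-1 : ℝ) ^ n • f n (-y))
      (fun n y => ?_) hM (fun n y => ?_) hmono hdiv (fun n => by simp [h0]) (neg_nonneg.2 hx)
    · simpa using this
    · have h1 := ((hf n (-y)).scomp y (hasDerivAt_neg y)).const_smul ((-1 : ℝ) ^ n)
      simpa [pow_succ, Function.comp_def, Pi.smul_def] using h1
    · simpa [norm_smul] using hfM n (-y)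

end Quasianalytic

theorem not_summable_ratio_of_carleman {m : ℕ → ℝ} (hm : ∀ n, 0 < m n)
    (h : ¬ Summable fun n : ℕ => m (n + 1) ^ (-(1 : ℝ) / (2 * ((n : ℝ) + 1)))) :
    ¬ Summable fun n => √(m n) / √(m (n + 1)) := by
  intro hs
  refine h (Summable.of_nonneg_of_le (fun n => Real.rpow_nonneg (hm _).le _) (fun n => ?_)
    ((summable_geomMean_of_summable (fun n => by positivity) hs).mul_left (max 1 (√(m 0))⁻¹)))
  have hsq : ∀ n, 0 < √(m n) := fun n => Real.sqrt_pos.2 (hm n)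
  have hprod : ∏ i ∈ Finset.range (n + 1), √(m i) / √(m (i + 1)) = √(m 0) / √(m (n + 1)) := by
    induction n with
    | zero => simp
    | succ n ih =>
      rw [Finset.prod_range_succ, ih, div_mul_div_cancel₀ (hsq _).ne']
  have hn : (0 : ℝ) < (n : ℝ) + 1 := by positivity
  have hterm : m (n + 1) ^ (-(1 : ℝ) / (2 * ((n : ℝ) + 1)))
      = ((√(m (n + 1))) ^ (((n : ℝ) + 1)⁻¹))⁻¹ := by
    rw [Real.sqrt_eq_rpow, ← Real.rpow_mul (hm _).le, ← Real.rpow_neg (hm _).le]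
    congr 1
    field_simp
  have hbound : ((√(m 0))⁻¹) ^ (((n : ℝ) + 1)⁻¹) ≤ max 1 (√(m 0))⁻¹ := by
    have h0 : 0 ≤ ((n : ℝ) + 1)⁻¹ := by positivity
    have h1 : ((n : ℝ) + 1)⁻¹ ≤ 1 := inv_le_one_of_one_le₀ (by linarith [(Nat.cast_nonneg n : (0:ℝ) ≤ n)])
    refine (Real.rpow_le_rpow (by positivity) (le_max_right 1 _) h0).trans ?_
    exact (Real.rpow_le_rpow_of_exponent_le (le_max_left _ _) h1).trans_eq (Real.rpow_one _)
  rw [hprod, hterm, Real.div_rpow (hsq _).le (hsq _).le]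
  rw [Real.inv_rpow (hsq _).le] at hbound
  have h2 : 0 < √(m 0) ^ (((n : ℝ) + 1)⁻¹) := Real.rpow_pos_of_pos (hsq 0) _
  have h3 : 0 < √(m (n + 1)) ^ (((n : ℝ) + 1)⁻¹) := Real.rpow_pos_of_pos (hsq _) _
  calc _ = (√(m 0) ^ (((n : ℝ) + 1)⁻¹))⁻¹ *
        (√(m 0) ^ (((n : ℝ) + 1)⁻¹) / √(m (n + 1)) ^ (((n : ℝ) + 1)⁻¹)) := by
        rw [← mul_div_assoc, inv_mul_cancel₀ h2.ne', one_div]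
    _ ≤ _ := mul_le_mul_of_nonneg_right hbound (div_pos h2 h3).le

theorem integral_abs_mul_le_sqrt_mul_sqrt {α : Type*} [MeasurableSpace α] {μ : Measure α}
    {u v : α → ℝ} (hu : MemLp u 2 μ) (hv : MemLp v 2 μ) :
    ∫ t, |u t * v t| ∂μ ≤ √(∫ t, u t ^ 2 ∂μ) * √(∫ t, v t ^ 2 ∂μ) := by
  have h2 : ENNReal.ofReal 2 = 2 := by simp
  have := integral_mul_le_Lp_mul_Lq_of_nonneg (μ := μ) (f := fun t => |u t|) (g := fun t => |v t|)
    Real.HolderConjugate.two_two (.of_forall fun t => abs_nonneg _)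
    (.of_forall fun t => abs_nonneg _) (by rw [h2]; exact hu.abs) (by rw [h2]; exact hv.abs)
  simpa [abs_mul, Real.sqrt_eq_rpow] using this

/-- A real integrable function whose Fourier transform vanishes is zero almost everywhere. -/
theorem ae_eq_zero_of_forall_integral_exp_eq_zero {μ : Measure ℝ} {g : ℝ → ℝ}
    (hg : Integrable g μ)
    (h : ∀ x : ℝ, ∫ t, (g t : ℂ) * Complex.exp (x * t * Complex.I) ∂μ = 0) : g =ᵐ[μ] 0 := by
  wlog hgm : Measurable g generalizing g
  · have hae := hg.1.aemeasurable.ae_eq_mk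
    refine hae.trans (this (hg.congr hae) (fun x => ?_) hg.1.aemeasurable.measurable_mk)
    rw [← h x]
    refine integral_congr_ae ?_
    filter_upwards [hae] with t ht
    rw [ht]
  have hfin1 := isFiniteMeasure_withDensity_ofReal hg.2
  have hfin2 := isFiniteMeasure_withDensity_ofReal hg.neg.2
  have hchar : charFun (μ.withDensity fun t => ENNReal.ofReal (g t))
      = charFun (μ.withDensity fun t => ENNReal.ofReal ((-g) t)) := by
    ext x
    rw [charFun_apply_real, charFun_apply_real,
      integral_withDensity_eq_integral_toReal_smul hgm.ennreal_ofReal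
        (.of_forall fun _ => ENNReal.ofReal_lt_top),
      integral_withDensity_eq_integral_toReal_smul hgm.neg.ennreal_ofReal
        (.of_forall fun _ => ENNReal.ofReal_lt_top), ← sub_eq_zero]
    have hint : ∀ k : ℝ → ℝ, Integrable k μ → Integrable
        (fun t : ℝ => (ENNReal.ofReal (k t)).toReal • Complex.exp (x * t * Complex.I)) μ := by
      intro k hk
      have : Integrable (fun t => (ENNReal.ofReal (k t)).toReal) μ := by
        simpa [ENNReal.toReal_ofReal'] using hk.pos_part
      refine this.smul_bdd (C := 1) (by fun_prop : Continuous fun t : ℝ =>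
        Complex.exp (x * t * Complex.I)).aestronglyMeasurable (.of_forall fun t => ?_)
      rw [← Complex.ofReal_mul, Complex.norm_exp_ofReal_mul_I]
    rw [← integral_sub (hint g hg) (hint (-g) hg.neg), ← h x]
    congr 1
    ext t
    rw [← sub_smul, Complex.real_smul]
    congr 2
    simp only [ENNReal.toReal_ofReal', Pi.neg_apply]
    rcases le_total 0 (g t) with h0 | h0
    · rw [max_eq_left h0, max_eq_right (neg_nonpos.2 h0), sub_zero]
    · rw [max_eq_right h0, max_eq_left (neg_nonneg.2 h0), zero_sub, neg_neg]
  have heq := Measure.ext_of_charFun hchar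
  rw [withDensity_eq_iff hgm.ennreal_ofReal.aemeasurable hgm.neg.ennreal_ofReal.aemeasurable
    hg.lintegral_lt_top.ne] at heq
  filter_upwards [heq] with t ht
  have ht' := congrArg ENNReal.toReal ht
  simp only [ENNReal.toReal_ofReal', Pi.neg_apply] at ht'
  rcases le_total 0 (g t) with h0 | h0
  · simpa [max_eq_left h0, max_eq_right (neg_nonpos.2 h0)] using ht'
  · simpa [max_eq_right h0, max_eq_left (neg_nonneg.2 h0)] using ht'.symm

section Moments

variable {μ : Measure ℝ}

theorem memLp_two_pow (hmom : ∀ m : ℕ, Integrable (fun t : ℝ => t ^ m) μ) (n : ℕ) :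
    MemLp (fun t : ℝ => t ^ n) 2 μ := by
  rw [memLp_two_iff_integrable_sq (by fun_prop)]
  simpa [← pow_mul] using hmom (n * 2)

theorem memLp_two_eval (hmom : ∀ m : ℕ, Integrable (fun t : ℝ => t ^ m) μ) (p : Polynomial ℝ) :
    MemLp (fun t => p.eval t) 2 μ := by
  simp only [Polynomial.eval_eq_sum_range]
  exact memLp_finsetSum _ fun i _ => (memLp_two_pow hmom i).const_mul _

theorem integral_pow_two_mul_pos (hmom : ∀ m : ℕ, Integrable (fun t : ℝ => t ^ m) μ)
    (hcarleman : ¬ Summable (fun m : ℕ =>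
      (∫ t : ℝ, t ^ (2 * (m + 1)) ∂μ) ^ (-(1:ℝ) / (2 * ((m : ℝ) + 1))))) (n : ℕ) :
    0 < ∫ t : ℝ, t ^ (2 * n) ∂μ := by
  have hnn : ∀ k, 0 ≤ fun t : ℝ => t ^ (2 * k) := fun k t => (even_two_mul k).pow_nonneg t
  refine (integral_nonneg (hnn n)).lt_of_ne fun h0 => hcarleman ?_
  have h1 := (integral_eq_zero_iff_of_nonneg (hnn n) (hmom _)).1 h0.symm
  have h2 : ∀ m : ℕ, ∫ t : ℝ, t ^ (2 * (m + 1)) ∂μ = 0 := by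
    intro m
    rw [integral_eq_zero_iff_of_nonneg (hnn _) (hmom _)]
    filter_upwards [h1] with t ht
    have : t = 0 := eq_zero_of_pow_eq_zero ht
    simp [this]
  refine summable_zero.congr fun m => ?_
  rw [h2, Real.zero_rpow]
  have : (0 : ℝ) < 2 * ((m : ℝ) + 1) := by positivity
  exact (div_neg_of_neg_of_pos (by norm_num) this).ne

theorem hasDerivAt_integral_pow_mul_exp (hmom : ∀ m : ℕ, Integrable (fun t : ℝ => t ^ m) μ)
    {g : ℝ → ℝ} (hg : MemLp g 2 μ) (n : ℕ) (x : ℝ) :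
    HasDerivAt (fun y : ℝ => ∫ t : ℝ, (t * Complex.I) ^ n * g t * Complex.exp (y * t * Complex.I) ∂μ)
      (∫ t : ℝ, (t * Complex.I) ^ (n + 1) * g t * Complex.exp (x * t * Complex.I) ∂μ) x := by
  have hgm := hg.1
  have hnorm : ∀ (k : ℕ) (y t : ℝ), ‖((t * Complex.I) ^ k * g t * Complex.exp (y * t * Complex.I) : ℂ)‖
      = |t ^ k * g t| := by
    intro k y t
    rw [norm_mul, ← Complex.ofReal_mul, Complex.norm_exp_ofReal_mul_I]
    simp
  have hmeas : ∀ (k : ℕ) (y : ℝ), AEStronglyMeasurable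
      (fun t : ℝ => ((t * Complex.I) ^ k * g t * Complex.exp (y * t * Complex.I) : ℂ)) μ := by
    intro k y
    have : AEStronglyMeasurable (fun t => (g t : ℂ)) μ :=
      Complex.continuous_ofReal.comp_aestronglyMeasurable hgm
    exact ((by fun_prop : Continuous fun t : ℝ => ((t : ℂ) * Complex.I) ^ k).aestronglyMeasurable.mul
      this).mul (by fun_prop : Continuous fun t : ℝ =>
        Complex.exp (y * t * Complex.I)).aestronglyMeasurable
  have hint : ∀ k : ℕ, Integrable (fun t : ℝ => |t ^ k * g t|) μ := fun k =>
    ((memLp_two_pow hmom k).integrable_mul hg).abs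
  refine (hasDerivAt_integral_of_dominated_loc_of_deriv_le (s := Set.univ) Filter.univ_mem
    (bound := fun t => |t ^ (n + 1) * g t|)
    (F := fun (y t : ℝ) => ((t * Complex.I) ^ n * g t * Complex.exp (y * t * Complex.I) : ℂ))
    (F' := fun (y t : ℝ) => ((t * Complex.I) ^ (n + 1) * g t * Complex.exp (y * t * Complex.I) : ℂ))
    (.of_forall fun y => hmeas n y) ?_ (hmeas _ _)
    (.of_forall fun t y _ => (hnorm _ _ _).le) (hint _) (.of_forall fun t y _ => ?_)).2
  · exact (hint n).mono (hmeas _ _) (.of_forall fun t => by rw [hnorm, Real.norm_eq_abs, abs_abs])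
  · have h1 : HasDerivAt (fun y : ℝ => (y : ℂ) * t * Complex.I) (t * Complex.I) y := by
      simpa using ((Complex.ofRealCLM.hasDerivAt (x := y)).mul_const (t : ℂ)).mul_const Complex.I
    have h2 := (h1.cexp).const_mul (((t : ℂ) * Complex.I) ^ n * g t)
    refine h2.congr_deriv ?_
    ring

/-- Under Carleman's condition, a square integrable function orthogonal to all monomials is zero. -/
theorem ae_eq_zero_of_forall_integral_pow_mul_eq_zero
    (hmom : ∀ m : ℕ, Integrable (fun t : ℝ => t ^ m) μ)
    (hcarleman : ¬ Summable (fun m : ℕ =>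
      (∫ t : ℝ, t ^ (2 * (m + 1)) ∂μ) ^ (-(1:ℝ) / (2 * ((m : ℝ) + 1)))))
    {g : ℝ → ℝ} (hg : MemLp g 2 μ) (h : ∀ n : ℕ, ∫ t, t ^ n * g t ∂μ = 0) : g =ᵐ[μ] 0 := by
  have hpos := integral_pow_two_mul_pos hmom hcarleman
  have hsq : ∀ n : ℕ, 0 < √(∫ t : ℝ, t ^ (2 * n) ∂μ) := fun n => Real.sqrt_pos.2 (hpos n)
  set C := √(∫ t, g t ^ 2 ∂μ) + 1 with hC
  have hC0 : 0 < C := by positivity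
  have hratio : ∀ a b : ℝ, C * a / (C * b) = a / b := fun a b => mul_div_mul_left _ _ hC0.ne'
  have hpowsq : ∀ n : ℕ, (fun t : ℝ => (t ^ n) ^ 2) = fun t => t ^ (2 * n) := by
    intro n
    ext t
    rw [← pow_mul, mul_comm]
  have hzero := eq_zero_of_denjoyCarleman
    (f := fun (n : ℕ) (x : ℝ) =>
      ∫ t : ℝ, (t * Complex.I) ^ n * g t * Complex.exp (x * t * Complex.I) ∂μ)
    (M := fun n => C * √(∫ t : ℝ, t ^ (2 * n) ∂μ))
    (hasDerivAt_integral_pow_mul_exp hmom hg) (fun n => mul_pos hC0 (hsq n)) (fun n x => ?_)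
    (monotone_nat_of_le_succ fun n => ?_) ?_ (fun n => ?_)
  · refine ae_eq_zero_of_forall_integral_exp_eq_zero ?_ fun x => by simpa using hzero x
    exact ((memLp_two_pow hmom 0).integrable_mul hg).congr (.of_forall fun t => by simp)
  · refine (norm_integral_le_integral_norm _).trans ?_
    have h1 : ∀ t : ℝ, ‖((t * Complex.I) ^ n * g t * Complex.exp (x * t * Complex.I) : ℂ)‖
        = |g t * t ^ n| := by
      intro t
      rw [norm_mul, ← Complex.ofReal_mul, Complex.norm_exp_ofReal_mul_I]
      simp [mul_comm]
    simp only [h1]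
    refine (integral_abs_mul_le_sqrt_mul_sqrt hg (memLp_two_pow hmom n)).trans ?_
    rw [hpowsq]
    exact mul_le_mul_of_nonneg_right (by rw [hC]; linarith) (hsq n).le
  · simp only [hratio]
    rw [div_le_div_iff₀ (hsq _) (hsq _), Real.mul_self_sqrt (hpos _).le]
    have h1 := integral_abs_mul_le_sqrt_mul_sqrt (memLp_two_pow hmom n) (memLp_two_pow hmom (n + 2))
    rw [hpowsq, hpowsq] at h1
    refine le_trans (le_of_eq ?_) (h1.trans_eq (mul_comm _ _))
    congr 1
    ext t
    rw [← pow_add, abs_of_nonneg (Even.pow_nonneg ⟨n + 1, by ring⟩ t)]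
    ring
  · simp only [hratio]
    exact not_summable_ratio_of_carleman (m := fun n => ∫ t : ℝ, t ^ (2 * n) ∂μ) hpos hcarleman
  · have h1 : ∀ t : ℝ, ((t * Complex.I) ^ n * g t * Complex.exp ((0 : ℝ) * t * Complex.I) : ℂ)
        = Complex.I ^ n * ((t ^ n * g t : ℝ) : ℂ) := by
      intro t
      simp
      ring
    simp only [h1]
    rw [integral_const_mul, integral_complex_ofReal, h n, Complex.ofReal_zero, mul_zero]

/-- Under Carleman's condition, the polynomials are dense in `L²`. -/
theorem exists_polynomial_eLpNorm_two_sub_lt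
    (hmom : ∀ m : ℕ, Integrable (fun t : ℝ => t ^ m) μ)
    (hcarleman : ¬ Summable (fun m : ℕ =>
      (∫ t : ℝ, t ^ (2 * (m + 1)) ∂μ) ^ (-(1:ℝ) / (2 * ((m : ℝ) + 1)))))
    {f : ℝ → ℝ} (hf : MemLp f 2 μ) {ε : ENNReal} (hε : ε ≠ 0) :
    ∃ p : Polynomial ℝ, eLpNorm (fun t => f t - p.eval t) 2 μ < ε := by
  let T : Polynomial ℝ →ₗ[ℝ] Lp ℝ 2 μ :=
    { toFun := fun p => (memLp_two_eval hmom p).toLp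
      map_add' := fun p q => by
        rw [← MemLp.toLp_add]
        simp only [Polynomial.eval_add]
        rfl
      map_smul' := fun c p => by
        rw [RingHom.id_apply, ← MemLp.toLp_const_smul]
        simp only [Polynomial.eval_smul]
        rfl }
  have hdense : Dense (LinearMap.range T : Set (Lp ℝ 2 μ)) := by
    rw [Submodule.dense_iff_topologicalClosure_eq_top, Submodule.topologicalClosure_eq_top_iff,
      Submodule.eq_bot_iff]
    intro g hg
    rw [Submodule.mem_orthogonal] at hg
    rw [Lp.eq_zero_iff_ae_eq_zero]
    refine ae_eq_zero_of_forall_integral_pow_mul_eq_zero hmom hcarleman (Lp.memLp g) fun n => ?_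
    have h1 := hg _ ⟨Polynomial.X ^ n, rfl⟩
    rw [L2.inner_def] at h1
    rw [← h1]
    refine integral_congr_ae ?_
    filter_upwards [(memLp_two_eval hmom (Polynomial.X ^ n)).coeFn_toLp] with t ht
    change _ = g t * (memLp_two_eval hmom (Polynomial.X ^ n)).toLp _ t
    rw [ht, Polynomial.eval_pow, Polynomial.eval_X, mul_comm]
  obtain ⟨_, hmem, p, rfl⟩ := hdense.inter_open_nonempty (Metric.eball (hf.toLp) ε)
    Metric.isOpen_eball ⟨_, Metric.mem_eball_self (pos_iff_ne_zero.2 hε)⟩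
  refine ⟨p, ?_⟩
  rw [Metric.mem_eball, edist_comm] at hmem
  exact (Lp.edist_toLp_toLp f _ hf (memLp_two_eval hmom p)).symm.trans_lt hmem

/-- Under Carleman's condition, the polynomials are dense in `L¹`. -/
theorem exists_polynomial_eLpNorm_one_sub_lt [IsFiniteMeasure μ]
    (hmom : ∀ m : ℕ, Integrable (fun t : ℝ => t ^ m) μ)
    (hcarleman : ¬ Summable (fun m : ℕ =>
      (∫ t : ℝ, t ^ (2 * (m + 1)) ∂μ) ^ (-(1:ℝ) / (2 * ((m : ℝ) + 1)))))
    {f : ℝ → ℝ} (hf : Integrable f μ) {ε : ENNReal} (hε : ε ≠ 0) :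
    ∃ p : Polynomial ℝ, eLpNorm (fun t => f t - p.eval t) 1 μ < ε := by
  obtain ⟨δ, hδ0, hδ⟩ := exists_between (pos_iff_ne_zero.2 hε)
  obtain ⟨g, hfg, -⟩ := (memLp_one_iff_integrable.2 hf).exists_boundedContinuous_eLpNorm_sub_le
    ENNReal.one_ne_top hδ0.ne'
  have hg : MemLp g 2 μ := MemLp.of_bound g.continuous.aestronglyMeasurable ‖g‖
    (.of_forall fun t => g.norm_coe_le_norm t)
  set c : ENNReal := μ Set.univ ^ (1 / (1 : ENNReal).toReal - 1 / (2 : ENNReal).toReal) with hc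
  have hctop : c ≠ ⊤ := ENNReal.rpow_ne_top_of_nonneg (by norm_num) (measure_ne_top μ _)
  have hεδ : ε - δ ≠ 0 := (tsub_pos_of_lt hδ).ne'
  obtain ⟨p, hp⟩ := exists_polynomial_eLpNorm_two_sub_lt hmom hcarleman hg
    (ENNReal.div_ne_zero.2 ⟨hεδ, hctop⟩ : (ε - δ) / c ≠ 0)
  refine ⟨p, ?_⟩
  have hpm : MemLp (fun t => g t - p.eval t) 2 μ := hg.sub (memLp_two_eval hmom p)
  have h1 : eLpNorm (fun t => g t - p.eval t) 1 μ < ε - δ :=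
    (eLpNorm_le_eLpNorm_mul_rpow_measure_univ one_le_two hpm.1).trans_lt (ENNReal.mul_lt_of_lt_div hp)
  calc eLpNorm (fun t => f t - p.eval t) 1 μ
      = eLpNorm ((f - ⇑g) + fun t => g t - p.eval t) 1 μ := by
        congr 1
        ext t
        simp
    _ ≤ eLpNorm (f - ⇑g) 1 μ + eLpNorm (fun t => g t - p.eval t) 1 μ :=
        eLpNorm_add_le (hf.1.sub g.continuous.aestronglyMeasurable) hpm.1 le_rfl
    _ < δ + (ε - δ) := ENNReal.add_lt_add_of_le_of_lt
        (hfg.trans_lt (hδ.trans_le le_top)).ne hfg h1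
    _ = ε := add_tsub_cancel_of_le hδ.le

end Moments

/-- The even part of a polynomial is a polynomial in the square of the variable. -/
theorem Polynomial.exists_eval_sq_eq_half_add (p : Polynomial ℝ) :
    ∃ q : Polynomial ℝ, ∀ t, q.eval (t ^ 2) = (p.eval t + p.eval (-t)) / 2 := by
  induction p using Polynomial.induction_on' with
  | add p₁ p₂ h₁ h₂ =>
    obtain ⟨q₁, hq₁⟩ := h₁
    obtain ⟨q₂, hq₂⟩ := h₂
    refine ⟨q₁ + q₂, fun t => ?_⟩
    simp only [Polynomial.eval_add, hq₁, hq₂]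
    ring
  | monomial n a =>
    rcases Nat.even_or_odd' n with ⟨k, rfl | rfl⟩
    · refine ⟨Polynomial.monomial k a, fun t => ?_⟩
      simp only [Polynomial.eval_monomial, pow_mul, neg_sq]
      ring
    · refine ⟨0, fun t => ?_⟩
      simp only [Polynomial.eval_monomial, Polynomial.eval_zero, pow_succ, pow_mul]
      ring

theorem stmt_3 (μ : Measure ℝ) [IsFiniteMeasure μ]
    (heven : μ.map (fun t => -t) = μ)
    (hmom : ∀ m : ℕ, Integrable (fun t : ℝ => t ^ m) μ)
    (hcarleman : ¬ Summable (fun m : ℕ =>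
      (∫ t : ℝ, t ^ (2 * (m + 1)) ∂μ) ^ (-(1:ℝ) / (2 * ((m : ℝ) + 1))))) :
    ∀ f : ℝ → ℝ, Integrable f μ → (∀ᵐ t ∂μ, f (-t) = f t) →
      ∀ ε : ℝ, 0 < ε →
        ∃ q : Polynomial ℝ, eLpNorm (fun t => f t - q.eval (t ^ 2)) 1 μ < ENNReal.ofReal ε := by
  intro f hf hfeven ε hε
  obtain ⟨p, hp⟩ := exists_polynomial_eLpNorm_one_sub_lt hmom hcarleman hf
    (ENNReal.ofReal_pos.2 hε).ne'
  obtain ⟨q, hq⟩ := p.exists_eval_sq_eq_half_add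
  refine ⟨q, lt_of_le_of_lt ?_ hp⟩
  set u : ℝ → ℝ := fun t => f t - p.eval t with hu
  have hneg : MeasurePreserving (fun t : ℝ => -t) μ μ := ⟨measurable_neg, heven⟩
  have hum : AEStronglyMeasurable u μ := hf.1.sub p.continuous.aestronglyMeasurable
  have hum' : AEStronglyMeasurable (u ∘ fun t => -t) μ := hum.comp_measurePreserving hneg
  calc eLpNorm (fun t => f t - q.eval (t ^ 2)) 1 μ
      = eLpNorm ((2⁻¹ : ℝ) • (u + u ∘ fun t => -t)) 1 μ := by
        refine eLpNorm_congr_ae ?_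
        filter_upwards [hfeven] with t ht
        simp only [Pi.smul_apply, Pi.add_apply, Function.comp_apply, smul_eq_mul, hu, hq, ht]
        ring
    _ = 2⁻¹ * eLpNorm (u + u ∘ fun t => -t) 1 μ := by
        rw [eLpNorm_const_smul, enorm_inv two_ne_zero]
        simp [Real.enorm_eq_ofReal_abs]
    _ ≤ 2⁻¹ * (eLpNorm u 1 μ + eLpNorm (u ∘ fun t => -t) 1 μ) :=
        mul_le_mul_right (eLpNorm_add_le hum hum' le_rfl) _
    _ = eLpNorm u 1 μ := by
        rw [eLpNorm_comp_measurePreserving hum hneg, ← two_mul, ← mul_assoc,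
          ENNReal.inv_mul_cancel two_ne_zero ENNReal.ofNat_ne_top, one_mul]
end

section
/- Let f ∈ L¹(ℝⁿ) vanish on an open set V containing an open neighbourhood of the origin, and define the spectral projections f ∗ φ_λ(x) = (2π)^{-n/2} ∫_{S^{n-1}} f̂(λω) e^{iλ x·ω} dσ(ω) for λ > 0. If θ is a positive decreasing function on [0,∞) vanishing at infinity with ∫₁^∞ θ(t)/t dt = ∞, then the estimate sup_{x ∈ Vᶜ} |f ∗ φ_λ(x)| ≤ C e^{-λθ(λ)} for all λ > 0 forces f = 0. -/
open MeasureTheory Set Filter Metric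
open scoped RealInnerProductSpace

/-- The Euclidean Fourier transform `f̂(ξ) = (2π)^{-n/2} ∫ f(x) e^{-i x·ξ} dx`. -/
noncomputable def fourierHat {n : ℕ} (f : EuclideanSpace ℝ (Fin n) → ℂ)
    (ξ : EuclideanSpace ℝ (Fin n)) : ℂ :=
  ((2 * Real.pi) ^ (-(n : ℝ) / 2) : ℝ) *
    ∫ x : EuclideanSpace ℝ (Fin n), f x * Complex.exp (-Complex.I * (⟪x, ξ⟫ : ℝ))

/-- The generalized spectral projection
`f ∗ φ_λ(x) = (2π)^{-n/2} ∫_{S^{n-1}} f̂(λω) e^{iλ x·ω} dσ(ω)`. -/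
noncomputable def spectralProj {n : ℕ} (f : EuclideanSpace ℝ (Fin n) → ℂ) (lam : ℝ)
    (x : EuclideanSpace ℝ (Fin n)) : ℂ :=
  ((2 * Real.pi) ^ (-(n : ℝ) / 2) : ℝ) *
    ∫ ω : sphere (0 : EuclideanSpace ℝ (Fin n)) 1,
      fourierHat f (lam • (ω : EuclideanSpace ℝ (Fin n))) *
        Complex.exp (Complex.I * lam * (⟪x, (ω : EuclideanSpace ℝ (Fin n))⟫ : ℝ))
      ∂((volume : Measure (EuclideanSpace ℝ (Fin n))).toSphere)


/-- One step of Bang's argument: exponential control of the derivatives of order at most `N`. -/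
lemma bang_step {G : ℕ → ℝ → ℂ} {a M : ℕ → ℝ} {N : ℕ} {β x₀ : ℝ}
    (ha_pos : ∀ k, 0 < a k) (ha_mono : Monotone a) (hM_pos : ∀ k, 0 < M k)
    (hM : ∀ k, M (k + 1) = M k * a k)
    (hG : ∀ k ≤ N, ∀ t, HasDerivAt (G k) (G (k + 1) t) t)
    (hGM : ∀ t, ‖G (N + 1) t‖ ≤ M (N + 1)) (hβ : Real.exp (-((N + 1 : ℕ) : ℝ)) ≤ β)
    (h₀ : ∀ k ≤ N, ‖G k x₀‖ ≤ β * Real.exp k * M k) :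
    ∀ k ≤ N + 1, ∀ t, x₀ ≤ t →
      ‖G k t‖ ≤ β * Real.exp k * M k * Real.exp (Real.exp 1 * a N * (t - x₀)) := by
  have hβ0 : 0 < β := (Real.exp_pos _).trans_le hβ
  have hc : 0 < Real.exp 1 * a N := mul_pos (Real.exp_pos _) (ha_pos N)
  intro k hk
  induction hk using Nat.decreasingInduction with
  | self =>
    intro t ht
    have h1 : 1 ≤ β * Real.exp ((N + 1 : ℕ) : ℝ) := by
      have := mul_le_mul_of_nonneg_right hβ (Real.exp_pos ((N + 1 : ℕ) : ℝ)).le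
      rwa [← Real.exp_add, neg_add_cancel, Real.exp_zero] at this
    have h2 : 1 ≤ Real.exp (Real.exp 1 * a N * (t - x₀)) :=
      Real.one_le_exp (mul_nonneg hc.le (sub_nonneg.2 ht))
    calc ‖G (N + 1) t‖ ≤ M (N + 1) := hGM t
      _ ≤ β * Real.exp ((N + 1 : ℕ) : ℝ) * M (N + 1) :=
        le_mul_of_one_le_left (hM_pos _).le h1
      _ ≤ _ := le_mul_of_one_le_right (by have := hM_pos (N + 1); positivity) h2
  | of_succ k hk ih =>
    intro t ht
    have hkN : k ≤ N := Nat.lt_succ_iff.1 hk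
    refine image_norm_le_of_norm_deriv_right_le_deriv_boundary (a := x₀) (b := t)
      (f := G k) (f' := G (k + 1))
      (B := fun t => β * Real.exp k * M k * Real.exp (Real.exp 1 * a N * (t - x₀)))
      (B' := fun t => β * Real.exp k * M k *
        (Real.exp (Real.exp 1 * a N * (t - x₀)) * (Real.exp 1 * a N)))
      (fun s _ => (hG k hkN s).continuousAt.continuousWithinAt)
      (fun s _ => (hG k hkN s).hasDerivWithinAt) (by simpa using h₀ k hkN) ?_ ?_
      ⟨ht, le_rfl⟩
    · intro s
      have h : HasDerivAt (fun t : ℝ => Real.exp 1 * a N * (t - x₀)) (Real.exp 1 * a N) s := by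
        simpa using ((hasDerivAt_id s).sub_const x₀).const_mul (Real.exp 1 * a N)
      exact h.exp.const_mul _
    · intro s hs
      refine (ih s hs.1).trans ?_
      rw [hM k]
      have h1 : Real.exp ((k + 1 : ℕ) : ℝ) = Real.exp k * Real.exp 1 := by
        rw [← Real.exp_add]; push_cast; rfl
      rw [h1]
      have h2 : a k ≤ a N := ha_mono hkN
      have h3 := hM_pos k
      calc _ = β * Real.exp k * M k * Real.exp (Real.exp 1 * a N * (s - x₀)) * Real.exp 1 * a k := by
            ring
        _ ≤ β * Real.exp k * M k * Real.exp (Real.exp 1 * a N * (s - x₀)) * Real.exp 1 * a N := by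
            gcongr
        _ = _ := by ring

/-- Bang's quantitative form of the Denjoy–Carleman theorem. -/
lemma bang_bound {G : ℕ → ℝ → ℂ} {a M : ℕ → ℝ} {m : ℕ}
    (ha_pos : ∀ k, 0 < a k) (ha_mono : Monotone a) (hM_pos : ∀ k, 0 < M k)
    (hM : ∀ k, M (k + 1) = M k * a k)
    (hG : ∀ k < m, ∀ t, HasDerivAt (G k) (G (k + 1) t) t)
    (hGM : ∀ k ≤ m, ∀ t, ‖G k t‖ ≤ M k) (h₀ : ∀ k ≤ m, G k 0 = 0)
    {j : ℕ} (hj : j ≤ m) :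
    ∀ k ≤ j, ∀ t, 0 ≤ t → t ≤ ∑ i ∈ Finset.Ico j m, (Real.exp 1 * a i)⁻¹ →
      ‖G k t‖ ≤ Real.exp (-(j : ℝ)) * Real.exp k * M k := by
  induction hj using Nat.decreasingInduction with
  | self =>
    intro k hk t ht ht'
    have : t = 0 := le_antisymm (by simpa using ht') ht
    subst this
    rw [h₀ k hk, norm_zero]
    have := hM_pos k
    positivity
  | of_succ j hj ih =>
    intro k hk t ht ht'
    set x₀ : ℝ := ∑ i ∈ Finset.Ico (j + 1) m, (Real.exp 1 * a i)⁻¹ with hx₀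
    have hx₀0 : 0 ≤ x₀ := Finset.sum_nonneg fun i _ => by have := ha_pos i; positivity
    have hsum : ∑ i ∈ Finset.Ico j m, (Real.exp 1 * a i)⁻¹ = (Real.exp 1 * a j)⁻¹ + x₀ :=
      Finset.sum_eq_sum_Ico_succ_bot hj _
    have hMk := hM_pos k
    have hexp : Real.exp (-((j + 1 : ℕ) : ℝ)) * Real.exp 1 = Real.exp (-(j : ℝ)) := by
      rw [← Real.exp_add]; push_cast; congr 1; ring
    rcases le_total t x₀ with h | h
    · refine (ih k (by omega) t ht h).trans ?_
      gcongr
      omega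
    · have := bang_step (x₀ := x₀) (N := j) ha_pos ha_mono hM_pos hM
        (fun k hk => hG k (by omega)) (hGM (j + 1) hj) le_rfl
        (fun k hk => ih k (by omega) x₀ hx₀0 le_rfl) k (by omega) t h
      refine this.trans ?_
      have haj := ha_pos j
      have h1 : Real.exp 1 * a j * (t - x₀) ≤ 1 := by
        have : t - x₀ ≤ (Real.exp 1 * a j)⁻¹ := by linarith
        calc _ ≤ Real.exp 1 * a j * (Real.exp 1 * a j)⁻¹ := by gcongr
          _ = 1 := mul_inv_cancel₀ (by positivity)
      calc _ ≤ Real.exp (-((j + 1 : ℕ) : ℝ)) * Real.exp k * M k * Real.exp 1 := by gcongr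
        _ = (Real.exp (-((j + 1 : ℕ) : ℝ)) * Real.exp 1) * Real.exp k * M k := by ring
        _ = _ := by rw [hexp]

lemma prod_max_one_div_le_exp {y : ℝ} (hy : 0 ≤ y) (k : ℕ) :
    ∏ i ∈ Finset.range k, max 1 (y / (i + 1)) ≤ Real.exp y := by
  induction k with
  | zero => simpa using Real.one_le_exp hy
  | succ k ih =>
    rcases le_total y (k + 1) with h | h
    · rw [Finset.prod_range_succ, max_eq_left ((div_le_one (by positivity)).2 h), mul_one]
      exact ih
    · have h1 : ∀ j ≤ k + 1, (j : ℝ) ≤ y → ∏ i ∈ Finset.range j, max 1 (y / (i + 1))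
          = y ^ j / (j.factorial : ℝ) := by
        intro j
        induction j with
        | zero => simp
        | succ j ihj =>
          intro hj hjy
          push_cast at hjy
          rw [Finset.prod_range_succ, ihj (by omega) (by linarith),
            max_eq_right ((one_le_div (by positivity)).2 hjy), Nat.factorial_succ]
          push_cast
          field_simp
          ring
      rw [h1 (k + 1) le_rfl (by push_cast; exact h)]
      exact Real.pow_div_factorial_le_exp y hy _

/-- The growth rates of the derivatives associated with the decay rate `θ`. -/
noncomputable def growthRate (θ : ℝ → ℝ) (K : ℝ) (k : ℕ) : ℝ :=
  K * (k + 1) / θ ((k + 1 : ℝ) ^ 4)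

section growthRate

variable {θ : ℝ → ℝ} {K : ℝ}

lemma growthRate_pos (hθ : ∀ t : ℝ, 0 ≤ t → 0 < θ t) (hK : 0 < K) (k : ℕ) :
    0 < growthRate θ K k := by
  have := hθ ((k + 1 : ℝ) ^ 4) (by positivity)
  unfold growthRate
  positivity

lemma growthRate_monotone (hθ : ∀ t : ℝ, 0 ≤ t → 0 < θ t) (hθ' : AntitoneOn θ (Ici 0))
    (hK : 0 < K) : Monotone (growthRate θ K) := by
  intro j k hjk
  have h2 := hθ ((k + 1 : ℝ) ^ 4) (by positivity)
  have h3 : (j : ℝ) ≤ k := by exact_mod_cast hjk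
  unfold growthRate
  gcongr ?_ / ?_
  · gcongr
  · exact hθ' (mem_Ici.2 (by positivity)) (mem_Ici.2 (by positivity)) (by gcongr)

lemma le_growthRate (hθ : ∀ t : ℝ, 0 ≤ t → 0 < θ t) (hθ' : AntitoneOn θ (Ici 0))
    (hK : 0 < K) (k : ℕ) : K / θ 0 ≤ growthRate θ K k := by
  have h2 := hθ ((k + 1 : ℝ) ^ 4) (by positivity)
  unfold growthRate
  gcongr ?_ / ?_
  · exact le_mul_of_one_le_right hK.le (by linarith [Nat.cast_nonneg (α := ℝ) k])
  · exact hθ' (mem_Ici.2 le_rfl) (mem_Ici.2 (by positivity)) (by positivity)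

/-- Products of mollifier factors turn the weight `exp (rθ(r) / 2)` into moment bounds. -/
lemma pow_mul_prod_le (hθ : ∀ t : ℝ, 0 ≤ t → 0 < θ t) (hθ' : AntitoneOn θ (Ici 0))
    {B : ℝ} (hB : 0 ≤ B) (hK2 : 2 ≤ K) (hKB : B * θ 0 ≤ K) (hK1 : θ 0 ≤ K)
    {k m : ℕ} (hkm : k ≤ m) {r : ℝ} (hr : 0 ≤ r) {w : ℕ → ℝ} (hw0 : ∀ i, 0 ≤ w i)
    (hw1 : ∀ i, w i ≤ 1) (hwB : ∀ i : ℕ, w i * r ^ 2 ≤ B * (i + 1) ^ 4) :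
    r ^ k * ∏ i ∈ Finset.range m, w i ≤
      Real.exp (r * θ r / 2) * ∏ i ∈ Finset.range k, growthRate θ K i := by
  have hK : 0 < K := by linarith
  have hθ0 := hθ 0 le_rfl
  have hθr := hθ r hr
  have hy : 0 ≤ r * θ r / K := by positivity
  have hfac : ∀ i, r * w i ≤ max 1 (r * θ r / K / (i + 1)) * growthRate θ K i := by
    intro i
    have ha := growthRate_pos hθ hK i
    have hl := le_growthRate hθ hθ' hK i
    have hone : 1 ≤ growthRate θ K i := le_trans ((one_le_div hθ0).2 hK1) hl
    have hBa : B ≤ growthRate θ K i := le_trans ((le_div_iff₀ hθ0).2 hKB) hl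
    rcases le_total ((i + 1 : ℝ) ^ 4) r with h | h
    · have hr' : 0 < r := lt_of_lt_of_le (by positivity) h
      calc r * w i ≤ B := by
            have h1 : r * w i * r ≤ B * r := by
              calc r * w i * r = w i * r ^ 2 := by ring
                _ ≤ B * (i + 1) ^ 4 := hwB i
                _ ≤ B * r := by gcongr
            exact le_of_mul_le_mul_right h1 hr'
        _ ≤ growthRate θ K i := hBa
        _ ≤ _ := le_mul_of_one_le_left ha.le (le_max_left _ _)
    · have hθi := hθ ((i + 1 : ℝ) ^ 4) (by positivity)
      have hθle : θ ((i + 1 : ℝ) ^ 4) ≤ θ r :=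
        hθ' (mem_Ici.2 hr) (mem_Ici.2 (by positivity)) h
      calc r * w i ≤ r := mul_le_of_le_one_right hr (hw1 i)
        _ ≤ r * θ r / K / (i + 1) * growthRate θ K i := by
            unfold growthRate
            rw [show r * θ r / K / (i + 1) * (K * (i + 1) / θ ((i + 1 : ℝ) ^ 4))
              = r * (θ r / θ ((i + 1 : ℝ) ^ 4)) by field_simp]
            exact le_mul_of_one_le_right hr ((one_le_div hθi).2 hθle)
        _ ≤ _ := by gcongr; exact le_max_right _ _
  calc r ^ k * ∏ i ∈ Finset.range m, w i
      ≤ r ^ k * ∏ i ∈ Finset.range k, w i := by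
        refine mul_le_mul_of_nonneg_left ?_ (pow_nonneg hr k)
        exact Finset.prod_le_prod_of_subset_of_le_one (Finset.range_subset_range.2 hkm)
          (fun i _ => hw0 i) (fun i _ _ => hw1 i)
    _ = ∏ i ∈ Finset.range k, r * w i := by simp [Finset.prod_mul_distrib]
    _ ≤ ∏ i ∈ Finset.range k, max 1 (r * θ r / K / (i + 1)) * growthRate θ K i :=
        Finset.prod_le_prod (fun i _ => mul_nonneg hr (hw0 i)) fun i _ => hfac i
    _ = (∏ i ∈ Finset.range k, max 1 (r * θ r / K / (i + 1))) *
          ∏ i ∈ Finset.range k, growthRate θ K i := Finset.prod_mul_distrib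
    _ ≤ Real.exp (r * θ r / 2) * ∏ i ∈ Finset.range k, growthRate θ K i := by
        have := Finset.prod_nonneg fun i (_ : i ∈ Finset.range k) => (growthRate_pos hθ hK i).le
        gcongr
        exact (prod_max_one_div_le_exp hy k).trans (Real.exp_le_exp.2 (by gcongr))

lemma not_summable_inv_growthRate (hθ : ∀ t : ℝ, 0 ≤ t → 0 < θ t)
    (hθ' : AntitoneOn θ (Ici 0)) (hK : 0 < K)
    (hdiv : ¬ IntegrableOn (fun t : ℝ => θ t / t) (Ici 1)) :
    ¬ Summable fun k => (Real.exp 1 * growthRate θ K k)⁻¹ := by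
  intro hs
  apply hdiv
  have hs' : Summable fun k : ℕ => 15 * (θ ((k + 1 : ℝ) ^ 4) / (k + 1)) := by
    refine (hs.mul_left (15 * (Real.exp 1 * K))).congr fun k => ?_
    have := hθ ((k + 1 : ℝ) ^ 4) (by positivity)
    unfold growthRate
    field_simp
  have hmeas : AEStronglyMeasurable (fun t : ℝ => θ t / t) (volume.restrict (Ici 1)) := by
    refine AEMeasurable.aestronglyMeasurable (AEMeasurable.div ?_ aemeasurable_id)
    exact aemeasurable_restrict_of_antitoneOn measurableSet_Ici
      (hθ'.mono (Ici_subset_Ici.2 zero_le_one))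
  refine ⟨hmeas, ?_⟩
  have hcover : Ici (1 : ℝ) ⊆ ⋃ k : ℕ, Ico ((k + 1 : ℝ) ^ 4) ((k + 2 : ℝ) ^ 4) := by
    intro t ht
    have ht1 : (1 : ℝ) ≤ t := ht
    obtain ⟨s, hs0, hst⟩ : ∃ s : ℝ, 1 ≤ s ∧ s ^ 4 = t := by
      refine ⟨t ^ ((4 : ℕ) : ℝ)⁻¹, Real.one_le_rpow ht1 (by positivity), ?_⟩
      exact Real.rpow_inv_natCast_pow (by linarith) (by norm_num)
    have hs1 : ((⌊s⌋₊ - 1 : ℕ) : ℝ) + 1 = ⌊s⌋₊ := by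
      have : 1 ≤ ⌊s⌋₊ := Nat.le_floor (by simpa using hs0)
      push_cast [Nat.cast_sub this]
      ring
    refine mem_iUnion.2 ⟨⌊s⌋₊ - 1, ?_, ?_⟩
    · rw [hs1, ← hst]
      gcongr
      exact Nat.floor_le (by linarith)
    · rw [show ((⌊s⌋₊ - 1 : ℕ) : ℝ) + 2 = ⌊s⌋₊ + 1 by linarith, ← hst]
      have := Nat.lt_floor_add_one s
      gcongr
  have hpiece : ∀ k : ℕ, ∫⁻ t in Ico ((k + 1 : ℝ) ^ 4) ((k + 2 : ℝ) ^ 4), ‖θ t / t‖ₑ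
      ≤ ENNReal.ofReal (15 * (θ ((k + 1 : ℝ) ^ 4) / (k + 1))) := by
    intro k
    have hpos := hθ ((k + 1 : ℝ) ^ 4) (by positivity)
    calc ∫⁻ t in Ico ((k + 1 : ℝ) ^ 4) ((k + 2 : ℝ) ^ 4), ‖θ t / t‖ₑ
        ≤ ∫⁻ t in Ico ((k + 1 : ℝ) ^ 4) ((k + 2 : ℝ) ^ 4),
            ENNReal.ofReal (θ ((k + 1 : ℝ) ^ 4) / (k + 1 : ℝ) ^ 4) := by
          refine setLIntegral_mono measurable_const fun t ht => ?_
          have ht0 : 0 < t := lt_of_lt_of_le (by positivity) ht.1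
          have hθt := hθ t ht0.le
          rw [Real.enorm_eq_ofReal (by positivity)]
          refine ENNReal.ofReal_le_ofReal ?_
          gcongr ?_ / ?_
          · exact hθ' (mem_Ici.2 (by positivity)) ht0.le ht.1
          · exact ht.1
      _ = ENNReal.ofReal (θ ((k + 1 : ℝ) ^ 4) / (k + 1 : ℝ) ^ 4 *
            ((k + 2 : ℝ) ^ 4 - (k + 1 : ℝ) ^ 4)) := by
          rw [setLIntegral_const, Real.volume_Ico, ENNReal.ofReal_mul (by positivity)]
      _ ≤ _ := by
          refine ENNReal.ofReal_le_ofReal ?_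
          have h15 : (k + 2 : ℝ) ^ 4 - (k + 1 : ℝ) ^ 4 ≤ 15 * (k + 1 : ℝ) ^ 3 := by
            have hk : (0 : ℝ) ≤ k := k.cast_nonneg
            nlinarith [pow_nonneg hk 2, pow_nonneg hk 3]
          calc _ ≤ θ ((k + 1 : ℝ) ^ 4) / (k + 1 : ℝ) ^ 4 * (15 * (k + 1 : ℝ) ^ 3) := by gcongr
            _ = _ := by field_simp
  calc ∫⁻ t in Ici 1, ‖θ t / t‖ₑ
      ≤ ∫⁻ t in ⋃ k : ℕ, Ico ((k + 1 : ℝ) ^ 4) ((k + 2 : ℝ) ^ 4), ‖θ t / t‖ₑ :=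
        lintegral_mono_set hcover
    _ ≤ ∑' k : ℕ, ∫⁻ t in Ico ((k + 1 : ℝ) ^ 4) ((k + 2 : ℝ) ^ 4), ‖θ t / t‖ₑ :=
        lintegral_iUnion_le _ _
    _ ≤ ∑' k : ℕ, ENNReal.ofReal (15 * (θ ((k + 1 : ℝ) ^ 4) / (k + 1))) :=
        ENNReal.tsum_le_tsum hpiece
    _ < ⊤ := hs'.tsum_ofReal_lt_top

end growthRate

/-- A trigonometric integral that vanishes near `0` and whose moments obey Denjoy–Carleman type
bounds is small on long intervals. -/
lemma norm_trig_integral_le {X : Type*} [MeasurableSpace X] {μ : Measure X} {p : X → ℝ}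
    (hp : Measurable p) {u : X → ℂ} (hu : AEStronglyMeasurable u μ) {W : X → ℝ}
    (hW : Integrable W μ) (hW0 : ∀ x, 0 ≤ W x) {a : ℕ → ℝ} (ha_pos : ∀ k, 0 < a k)
    (ha_mono : Monotone a) {m : ℕ}
    (hbound : ∀ k ≤ m, ∀ x, ‖u x‖ * |p x| ^ k ≤ W x * ∏ i ∈ Finset.range k, a i)
    (hvan : ∀ᶠ t : ℝ in nhds 0, ∫ x, u x * Complex.exp (Complex.I * t * p x) ∂μ = 0)
    {j : ℕ} (hj : j ≤ m) {t : ℝ} (ht0 : 0 ≤ t)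
    (ht : t ≤ ∑ i ∈ Finset.Ico j m, (Real.exp 1 * a i)⁻¹) :
    ‖∫ x, u x * Complex.exp (Complex.I * t * p x) ∂μ‖ ≤
      Real.exp (-(j : ℝ)) * (∫ x, W x ∂μ + 1) := by
  set F : ℕ → ℝ → X → ℂ := fun k t x =>
    u x * (Complex.I * p x) ^ k * Complex.exp (Complex.I * t * p x) with hF
  set M : ℕ → ℝ := fun k => (∫ x, W x ∂μ + 1) * ∏ i ∈ Finset.range k, a i with hM
  have hP : ∀ k, 0 < ∏ i ∈ Finset.range k, a i := fun k =>
    Finset.prod_pos fun i _ => ha_pos i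
  have hWi : 0 ≤ ∫ x, W x ∂μ := integral_nonneg hW0
  have hFmeas : ∀ k t, AEStronglyMeasurable (F k t) μ := fun k t => by
    refine (hu.mul ?_).mul ?_ <;> exact (by fun_prop : Measurable _).aestronglyMeasurable
  have hFnorm : ∀ k t x, ‖F k t x‖ = ‖u x‖ * |p x| ^ k := fun k t x => by
    have : Complex.I * t * p x = ((t * p x : ℝ) : ℂ) * Complex.I := by push_cast; ring
    simp only [hF, norm_mul, norm_pow, Complex.norm_I, one_mul, Complex.norm_real, this,
      Complex.norm_exp_ofReal_mul_I, mul_one, Real.norm_eq_abs]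
  have hFint : ∀ k ≤ m, ∀ t, Integrable (F k t) μ := fun k hk t =>
    (hW.mul_const _).mono' (hFmeas k t)
      (Filter.Eventually.of_forall fun x => by rw [hFnorm]; exact hbound k hk x)
  have hG : ∀ k < m, ∀ t, HasDerivAt (fun t => ∫ x, F k t x ∂μ) (∫ x, F (k + 1) t x ∂μ) t := by
    intro k hk t
    refine (hasDerivAt_integral_of_dominated_loc_of_deriv_le (F := F k) (F' := F (k + 1))
      (bound := fun x => W x * ∏ i ∈ Finset.range (k + 1), a i) Filter.univ_mem
      (Filter.Eventually.of_forall fun s => hFmeas k s) (hFint k hk.le t) (hFmeas _ _)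
      (Filter.Eventually.of_forall fun x s _ => by rw [hFnorm]; exact hbound (k + 1) hk x)
      (hW.mul_const _) (Filter.Eventually.of_forall fun x s _ => ?_)).2
    have h1 : HasDerivAt (fun s : ℝ => Complex.I * (s : ℂ) * p x) (Complex.I * 1 * p x) s :=
      ((Complex.ofRealCLM.hasDerivAt (x := s)).const_mul Complex.I).mul_const _
    refine (h1.cexp.const_mul (u x * (Complex.I * p x) ^ k)).congr_deriv ?_
    simp only [hF, pow_succ]
    ring
  have hzero : ∀ k ≤ m, ∀ᶠ t : ℝ in nhds 0, ∫ x, F k t x ∂μ = 0 := by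
    intro k
    induction k with
    | zero => intro _; simpa [hF] using hvan
    | succ k ih =>
      intro hk
      filter_upwards [(ih (by omega)).eventually_nhds] with t ht
      have h1 : HasDerivAt (fun t => ∫ x, F k t x ∂μ) 0 t :=
        (hasDerivAt_const t (0 : ℂ)).congr_of_eventuallyEq ht
      exact (hG k hk t).unique h1
  have key := bang_bound (G := fun k t => ∫ x, F k t x ∂μ) (M := M) ha_pos ha_mono
    (fun k => mul_pos (by linarith) (hP k))
    (fun k => by simp only [hM, Finset.prod_range_succ]; ring) hG
    (fun k hk t => ?_) (fun k hk => (hzero k hk).self_of_nhds) hj 0 (Nat.zero_le _) t ht0 ht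
  · simpa [hF, hM] using key
  · calc ‖∫ x, F k t x ∂μ‖ ≤ ∫ x, W x * ∏ i ∈ Finset.range k, a i ∂μ :=
          norm_integral_le_of_norm_le (hW.mul_const _)
            (Filter.Eventually.of_forall fun x => by rw [hFnorm]; exact hbound k hk x)
      _ = (∫ x, W x ∂μ) * ∏ i ∈ Finset.range k, a i := integral_mul_const _ _
      _ ≤ M k := by
          have := hP k
          simp only [hM]
          gcongr
          linarith

section mollifier

variable {n : ℕ}

/-- A probability measure on the unit ball whose characteristic function decays quadratically. -/
lemma exists_probabilityMeasure_charFun_decay (n : ℕ) :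
    ∃ (μ : Measure (EuclideanSpace ℝ (Fin n))) (A : ℝ), IsProbabilityMeasure μ ∧ 0 ≤ A ∧
      (∀ᵐ x ∂μ, ‖x‖ ≤ 1) ∧ ∀ ξ, ‖charFun μ ξ‖ * ‖ξ‖ ^ 2 ≤ A := by
  set φ : ContDiffBump (0 : EuclideanSpace ℝ (Fin n)) := ⟨1 / 2, 1, by norm_num, by norm_num⟩
  set ψ : EuclideanSpace ℝ (Fin n) → ℝ := φ.normed volume with hψ
  have hψ0 : ∀ x, 0 ≤ ψ x := φ.nonneg_normed
  have hψm : Measurable ψ := φ.continuous_normed.measurable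
  set S : SchwartzMap (EuclideanSpace ℝ (Fin n)) ℂ :=
    HasCompactSupport.toSchwartzMap (f := fun x => (ψ x : ℂ))
      (φ.hasCompactSupport_normed.comp_left (g := fun x : ℝ => (x : ℂ)) (by simp))
      (Complex.ofRealCLM.contDiff.comp φ.contDiff_normed) with hS
  obtain ⟨A, hA⟩ := (FourierTransform.fourier S).decay 2 0
  refine ⟨volume.withDensity fun x => ENNReal.ofReal (ψ x), A * (2 * Real.pi) ^ 2, ⟨?_⟩, ?_, ?_, ?_⟩
  · rw [withDensity_apply _ MeasurableSet.univ, setLIntegral_univ,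
      ← ofReal_integral_eq_lintegral_ofReal φ.integrable_normed
        (Filter.Eventually.of_forall hψ0), φ.integral_normed, ENNReal.ofReal_one]
  · exact mul_nonneg hA.1.le (by positivity)
  · rw [ae_withDensity_iff hψm.ennreal_ofReal]
    refine Filter.Eventually.of_forall fun x hx => ?_
    have hx' : x ∈ Function.support ψ := fun h => hx (by simp [h])
    rw [hψ, φ.support_normed_eq] at hx'
    simpa using (mem_ball.1 hx').le
  · intro ξ
    have h1 : charFun (volume.withDensity fun x => ENNReal.ofReal (ψ x)) ξ =
        FourierTransform.fourier S (-((2 * Real.pi)⁻¹ • ξ)) := by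
      rw [charFun_apply, integral_withDensity_eq_integral_toReal_smul hψm.ennreal_ofReal
        (Filter.Eventually.of_forall fun x => ENNReal.ofReal_lt_top), SchwartzMap.fourier_coe,
        Real.fourier_eq']
      refine integral_congr_ae (Filter.Eventually.of_forall fun x => ?_)
      simp only [ENNReal.toReal_ofReal (hψ0 x), hS, inner_neg_right, inner_smul_right,
        smul_eq_mul, Complex.real_smul]
      rw [mul_comm]
      congr 2
      have : (Real.pi : ℂ) ≠ 0 := by exact_mod_cast Real.pi_ne_zero
      push_cast
      field_simp
    have h2 := hA.2 (-((2 * Real.pi)⁻¹ • ξ))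
    rw [norm_iteratedFDeriv_zero, ← h1, norm_neg, norm_smul, Real.norm_of_nonneg (by positivity)]
      at h2
    have hpi := Real.pi_pos
    calc _ = ((2 * Real.pi)⁻¹ * ‖ξ‖) ^ 2 *
          ‖charFun (volume.withDensity fun x => ENNReal.ofReal (ψ x)) ξ‖ * (2 * Real.pi) ^ 2 := by
            field_simp
      _ ≤ _ := by gcongr

/-- Probability measures on the ball of radius `ρ` whose characteristic functions are products of
`m` factors bounded by `1` and decaying quadratically, uniformly in `m`. -/
lemma exists_mollifier (n : ℕ) {ρ : ℝ} (hρ : 0 < ρ) :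
    ∃ B : ℝ, 0 ≤ B ∧ ∀ m : ℕ, ∃ ν : Measure (EuclideanSpace ℝ (Fin n)),
      IsProbabilityMeasure ν ∧ (∀ᵐ x ∂ν, ‖x‖ ≤ ρ) ∧
      ∀ ξ, ∃ w : ℕ → ℝ, (∀ i, 0 ≤ w i) ∧ (∀ i, w i ≤ 1) ∧
        (∀ i : ℕ, w i * ‖ξ‖ ^ 2 ≤ B * (i + 1) ^ 4) ∧
        ‖charFun ν ξ‖ = ∏ i ∈ Finset.range m, w i := by
  obtain ⟨μ, A, hμ, hA, hsupp, hdec⟩ := exists_probabilityMeasure_charFun_decay n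
  set δ : ℕ → ℝ := fun i => ρ / ((i + 1) * (i + 2)) with hδ
  have hδ0 : ∀ i, 0 < δ i := fun i => by simp only [hδ]; positivity
  have hmain : ∀ m : ℕ, ∃ ν : Measure (EuclideanSpace ℝ (Fin n)), IsProbabilityMeasure ν ∧
      (∀ᵐ x ∂ν, ‖x‖ ≤ ρ * (1 - 1 / (m + 1))) ∧
      ∀ ξ, ‖charFun ν ξ‖ = ∏ i ∈ Finset.range m, ‖charFun μ (δ i • ξ)‖ := by
    intro m
    induction m with
    | zero => exact ⟨Measure.dirac 0, inferInstance, by simp [ae_dirac_eq], by simp⟩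
    | succ m ih =>
      obtain ⟨ν, hν, hνs, hνc⟩ := ih
      have hsm : Measurable fun x : EuclideanSpace ℝ (Fin n) => δ m • x := by fun_prop
      have hp : IsProbabilityMeasure (μ.map (δ m • ·)) :=
        Measure.isProbabilityMeasure_map hsm.aemeasurable
      have hs : ∀ᵐ x ∂(μ.map (δ m • ·)), ‖x‖ ≤ δ m := by
        rw [ae_map_iff hsm.aemeasurable (measurableSet_le measurable_norm measurable_const)]
        filter_upwards [hsupp] with x hx
        rw [norm_smul, Real.norm_of_nonneg (hδ0 m).le]
        exact mul_le_of_le_one_right (hδ0 m).le hx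
      refine ⟨Measure.conv ν (μ.map (δ m • ·)), inferInstance, ?_, fun ξ => ?_⟩
      · rw [Measure.conv, ae_map_iff (by fun_prop)
          (measurableSet_le measurable_norm measurable_const)]
        filter_upwards [Measure.quasiMeasurePreserving_fst.ae hνs,
          Measure.quasiMeasurePreserving_snd.ae hs] with x hx hy
        refine (norm_add_le _ _).trans ((add_le_add hx hy).trans (le_of_eq ?_))
        simp only [hδ]
        push_cast
        field_simp
        ring
      · rw [charFun_conv, norm_mul, hνc, charFun_map_smul, Finset.prod_range_succ]
  refine ⟨4 * A / ρ ^ 2, by positivity, fun m => ?_⟩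
  obtain ⟨ν, hν, hνs, hνc⟩ := hmain m
  refine ⟨ν, hν, ?_, fun ξ => ⟨fun i => ‖charFun μ (δ i • ξ)‖, fun i => norm_nonneg _,
    fun i => norm_charFun_le_one _, fun i => ?_, hνc ξ⟩⟩
  · filter_upwards [hνs] with x hx
    refine hx.trans (mul_le_of_le_one_right hρ.le ?_)
    have : (0 : ℝ) ≤ 1 / (m + 1) := by positivity
    linarith
  · have h := hdec (δ i • ξ)
    have hd := hδ0 i
    rw [norm_smul, Real.norm_of_nonneg hd.le] at h
    have h2 : ρ / (2 * (i + 1) ^ 2) ≤ δ i := by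
      simp only [hδ]
      have hi : (0 : ℝ) ≤ i := i.cast_nonneg
      refine div_le_div_of_nonneg_left hρ.le (by positivity) ?_
      nlinarith
    have h3 : ‖charFun μ (δ i • ξ)‖ * ‖ξ‖ ^ 2 * (ρ / (2 * (i + 1) ^ 2)) ^ 2 ≤ A := by
      calc _ ≤ ‖charFun μ (δ i • ξ)‖ * ‖ξ‖ ^ 2 * (δ i) ^ 2 := by gcongr
        _ = ‖charFun μ (δ i • ξ)‖ * (δ i * ‖ξ‖) ^ 2 := by ring
        _ ≤ A := h
    rw [← le_div_iff₀ (by positivity)] at h3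
    refine h3.trans (le_of_eq ?_)
    field_simp
    norm_num

end mollifier

open FourierTransform in
/-- An Ingham type theorem: a continuous function vanishing near the origin whose Fourier
transform is integrable against `exp (rθ(r) / 2)`, with `∫₁^∞ θ(t) / t dt = ∞`, is zero. -/
theorem eq_zero_of_integrable_fourier_mul_exp {n : ℕ} {h : EuclideanSpace ℝ (Fin n) → ℂ}
    (hcont : Continuous h) (hint : Integrable h) {r : ℝ} (hr : 0 < r)
    (hvan : ∀ x, ‖x‖ < r → h x = 0) {θ : ℝ → ℝ} (hθ : ∀ t : ℝ, 0 ≤ t → 0 < θ t)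
    (hθ' : AntitoneOn θ (Ici 0)) (hdiv : ¬ IntegrableOn (fun t : ℝ => θ t / t) (Ici 1))
    (hW : Integrable fun ξ : EuclideanSpace ℝ (Fin n) =>
      ‖𝓕 h ξ‖ * Real.exp (‖(2 * Real.pi) • ξ‖ * θ ‖(2 * Real.pi) • ξ‖ / 2))
    (x : EuclideanSpace ℝ (Fin n)) : h x = 0 := by
  set W : EuclideanSpace ℝ (Fin n) → ℝ := fun ξ =>
      ‖𝓕 h ξ‖ * Real.exp (‖(2 * Real.pi) • ξ‖ * θ ‖(2 * Real.pi) • ξ‖ / 2) with hWdef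
  have hW0 : ∀ ξ, 0 ≤ W ξ := fun ξ => by positivity
  have hFcont : Continuous (𝓕 h) :=
    VectorFourier.fourierIntegral_continuous Real.continuous_fourierChar
      (by exact continuous_inner) hint
  have hFint : Integrable (𝓕 h) := by
    refine hW.mono' hFcont.aestronglyMeasurable (Filter.Eventually.of_forall fun ξ => ?_)
    refine le_mul_of_one_le_right (norm_nonneg _) (Real.one_le_exp ?_)
    have := hθ ‖(2 * Real.pi) • ξ‖ (norm_nonneg _)
    positivity
  have hinv : ∀ y, h y = ∫ ξ, Complex.exp ((2 * Real.pi * ⟪ξ, y⟫ : ℝ) * Complex.I) * 𝓕 h ξ := by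
    intro y
    conv_lhs => rw [← hcont.fourierInv_fourier_eq hint hFint]
    rw [Real.fourierInv_eq']
    simp only [smul_eq_mul]
  refine norm_le_zero_iff.1 (le_of_forall_pos_le_add fun ε hε => ?_)
  obtain ⟨ρ₀, hρ₀, hclose⟩ := Metric.continuousAt_iff.1 (hcont.continuousAt (x := x)) (ε / 2)
    (half_pos hε)
  obtain ⟨ρ, hρ, hρr, hρρ₀⟩ : ∃ ρ, 0 < ρ ∧ ρ < r ∧ ρ < ρ₀ := by
    refine ⟨min r ρ₀ / 2, by positivity, ?_, ?_⟩
    · linarith [min_le_left r ρ₀]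
    · linarith [min_le_right r ρ₀]
  obtain ⟨B, hB, hmoll⟩ := exists_mollifier n hρ
  have hθ0 := hθ 0 le_rfl
  set K : ℝ := max 2 (max (B * θ 0) (θ 0)) with hKdef
  have hK2 : 2 ≤ K := le_max_left _ _
  have hKB : B * θ 0 ≤ K := (le_max_left _ _).trans (le_max_right _ _)
  have hK1 : θ 0 ≤ K := (le_max_right _ _).trans (le_max_right _ _)
  have hK : 0 < K := by linarith
  have hapos := growthRate_pos hθ hK
  obtain ⟨j, hj⟩ : ∃ j : ℕ, Real.exp (-(j : ℝ)) * ((∫ ξ, W ξ) + 1) ≤ ε / 2 := by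
    have h1 : Tendsto (fun j : ℕ => Real.exp (-(j : ℝ)) * ((∫ ξ, W ξ) + 1)) atTop
        (nhds (0 * ((∫ ξ, W ξ) + 1))) :=
      (Real.tendsto_exp_neg_atTop_nhds_zero.comp tendsto_natCast_atTop_atTop).mul_const _
    rw [zero_mul] at h1
    exact (h1.eventually (ge_mem_nhds (half_pos hε))).exists
  obtain ⟨m, hjm, hm⟩ : ∃ m, j ≤ m ∧
      ‖x‖ ≤ ∑ i ∈ Finset.Ico j m, (Real.exp 1 * growthRate θ K i)⁻¹ := by
    have h1 : Tendsto (fun m => ∑ i ∈ Finset.range m, (Real.exp 1 * growthRate θ K i)⁻¹)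
        atTop atTop := by
      refine (not_summable_iff_tendsto_nat_atTop_of_nonneg fun i => ?_).1
        (not_summable_inv_growthRate hθ hθ' hK hdiv)
      have := hapos i
      positivity
    obtain ⟨m, hm1, hm2⟩ := ((eventually_ge_atTop j).and (h1.eventually (eventually_ge_atTop
      (‖x‖ + ∑ i ∈ Finset.range j, (Real.exp 1 * growthRate θ K i)⁻¹)))).exists
    refine ⟨m, hm1, ?_⟩
    rw [Finset.sum_Ico_eq_sub _ hm1]
    linarith
  obtain ⟨ν, hν, hνs, hνc⟩ := hmoll m
  set H : EuclideanSpace ℝ (Fin n) → ℂ := fun y => ∫ z, h (y + z) ∂ν with hH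
  set u : EuclideanSpace ℝ (Fin n) → ℂ := fun ξ => 𝓕 h ξ * charFun ν ((2 * Real.pi) • ξ) with hu
  have hHu : ∀ y, H y = ∫ ξ, u ξ * Complex.exp ((2 * Real.pi * ⟪ξ, y⟫ : ℝ) * Complex.I) := by
    intro y
    have hprod : Integrable (Function.uncurry fun z ξ : EuclideanSpace ℝ (Fin n) =>
        Complex.exp ((2 * Real.pi * ⟪ξ, y + z⟫ : ℝ) * Complex.I) * 𝓕 h ξ) (ν.prod volume) := by
      have h1 : Integrable (fun q : EuclideanSpace ℝ (Fin n) × EuclideanSpace ℝ (Fin n) =>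
          𝓕 h q.2) (ν.prod volume) := hFint.comp_snd ν
      refine h1.mono (Continuous.aestronglyMeasurable ?_) (Filter.Eventually.of_forall fun q => ?_)
      · simp only [Function.uncurry_def]
        fun_prop
      · simp only [Function.uncurry_def, norm_mul, Complex.norm_exp_ofReal_mul_I, one_mul, le_refl]
    simp only [hH]
    simp_rw [hinv]
    rw [integral_integral_swap hprod]
    refine integral_congr_ae (Filter.Eventually.of_forall fun ξ => ?_)
    simp only [hu, charFun_apply]
    rw [integral_mul_const, mul_comm, mul_assoc, ← integral_mul_const]
    congr 2
    ext z
    rw [← Complex.exp_add, inner_add_right, inner_smul_right, real_inner_comm ξ z]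
    congr 1
    push_cast
    ring
  set v : EuclideanSpace ℝ (Fin n) := ‖x‖⁻¹ • x with hv
  have hvx : ‖x‖ • v = x := by
    rcases eq_or_ne x 0 with rfl | hx
    · simp
    · rw [hv, smul_smul, mul_inv_cancel₀ (norm_ne_zero_iff.2 hx), one_smul]
  have hv1 : ‖v‖ ≤ 1 := by
    rw [hv, norm_smul, norm_inv, norm_norm]
    exact inv_mul_le_one
  have hline : ∀ t : ℝ, H (t • v) =
      ∫ ξ, u ξ * Complex.exp (Complex.I * t * (2 * Real.pi * ⟪ξ, v⟫ : ℝ)) := by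
    intro t
    rw [hHu]
    refine integral_congr_ae (Filter.Eventually.of_forall fun ξ => ?_)
    simp only [inner_smul_right]
    congr 2
    push_cast
    ring
  have hHx : ‖H x‖ ≤ ε / 2 := by
    rw [← hvx, hline]
    have hum : AEStronglyMeasurable u volume := hFcont.aestronglyMeasurable.mul
      (measurable_charFun.comp (by fun_prop)).aestronglyMeasurable
    refine (norm_trig_integral_le (u := u) (p := fun ξ => 2 * Real.pi * ⟪ξ, v⟫) (by fun_prop)
      hum hW hW0 hapos
      (growthRate_monotone hθ hθ' hK) (m := m) (fun k hk ξ => ?_) ?_ hjm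
      (norm_nonneg x) hm).trans hj
    · obtain ⟨w, hw0, hw1, hwB, hwc⟩ := hνc ((2 * Real.pi) • ξ)
      have hp : |2 * Real.pi * ⟪ξ, v⟫| ≤ ‖(2 * Real.pi) • ξ‖ := by
        rw [abs_mul, norm_smul, Real.norm_eq_abs]
        gcongr
        exact (abs_real_inner_le_norm ξ v).trans (mul_le_of_le_one_right (norm_nonneg _) hv1)
      calc ‖u ξ‖ * |2 * Real.pi * ⟪ξ, v⟫| ^ k
          ≤ ‖u ξ‖ * ‖(2 * Real.pi) • ξ‖ ^ k := by gcongr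
        _ = ‖𝓕 h ξ‖ * (‖(2 * Real.pi) • ξ‖ ^ k * ∏ i ∈ Finset.range m, w i) := by
            simp only [hu, norm_mul, hwc]
            ring
        _ ≤ ‖𝓕 h ξ‖ * (Real.exp (‖(2 * Real.pi) • ξ‖ * θ ‖(2 * Real.pi) • ξ‖ / 2) *
              ∏ i ∈ Finset.range k, growthRate θ K i) := by
            refine mul_le_mul_of_nonneg_left ?_ (norm_nonneg _)
            exact pow_mul_prod_le hθ hθ' hB hK2 hKB hK1 hk (norm_nonneg _) hw0 hw1 hwB
        _ = _ := by simp only [hWdef]; ring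
    · filter_upwards [Metric.ball_mem_nhds (0 : ℝ) (sub_pos.2 hρr)] with t ht
      rw [← hline]
      refine integral_eq_zero_of_ae ?_
      filter_upwards [hνs] with z hz
      refine hvan _ ((norm_add_le _ _).trans_lt ?_)
      have h1 : ‖t • v‖ ≤ |t| := by
        rw [norm_smul, Real.norm_eq_abs]
        exact mul_le_of_le_one_right (abs_nonneg t) hv1
      have h2 : |t| < r - ρ := by simpa using ht
      linarith
  have hdiff : ‖h x - H x‖ ≤ ε / 2 := by
    have hclose' : ∀ᵐ z ∂ν, ‖h x - h (x + z)‖ ≤ ε / 2 := by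
      filter_upwards [hνs] with z hz
      rw [norm_sub_rev, ← dist_eq_norm]
      exact (hclose (by simpa [dist_eq_norm] using lt_of_le_of_lt hz hρρ₀)).le
    have hi : Integrable (fun z => h (x + z)) ν := by
      have hm : AEStronglyMeasurable (fun z => h (x + z)) ν :=
        (by fun_prop : Continuous fun z => h (x + z)).aestronglyMeasurable
      refine (integrable_const (‖h x‖ + ε / 2)).mono' hm ?_
      filter_upwards [hclose'] with z hz
      rw [norm_sub_rev] at hz
      linarith [norm_sub_norm_le (h (x + z)) (h x)]
    have h1 : h x - H x = ∫ z, (h x - h (x + z)) ∂ν := by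
      rw [integral_sub (integrable_const _) hi]
      simp [hH]
    rw [h1]
    simpa using norm_integral_le_of_norm_le_const hclose'
  calc ‖h x‖ = ‖(h x - H x) + H x‖ := by rw [sub_add_cancel]
    _ ≤ ‖h x - H x‖ + ‖H x‖ := norm_add_le _ _
    _ ≤ 0 + ε := by linarith

/-- Integrability in polar coordinates: a continuous function times a radial weight is integrable
if its weighted spherical means are dominated by an integrable radial function. -/
lemma integrable_mul_comp_norm {E : Type*} [NormedAddCommGroup E] [NormedSpace ℝ E]
    [FiniteDimensional ℝ E] [MeasurableSpace E] [BorelSpace E] [Nontrivial E] (μ : Measure E)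
    [μ.IsAddHaarMeasure] {Φ : E → ℝ} (hΦ : Continuous Φ) (hΦ0 : ∀ x, 0 ≤ Φ x) {w v : ℝ → ℝ}
    (hw : Measurable w) (hw0 : ∀ r, 0 ≤ w r) (hv : Integrable (fun x => v ‖x‖) μ)
    (h : ∀ r : ℝ, 0 < r → (∫ ω : sphere (0 : E) 1, Φ (r • (ω : E)) ∂μ.toSphere) * w r ≤ v r) :
    Integrable (fun x => Φ x * w ‖x‖) μ := by
  have polar : ∀ g : E → ℝ, Integrable g μ ↔
      Integrable (fun q : sphere (0 : E) 1 × Ioi (0 : ℝ) => g ((q.2 : ℝ) • (q.1 : E)))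
        (μ.toSphere.prod (Measure.volumeIoiPow (Module.finrank ℝ E - 1))) := by
    intro g
    rw [← μ.measurePreserving_homeomorphUnitSphereProd.integrable_comp_emb
      (Homeomorph.measurableEmbedding _)]
    have h1 : (fun q : sphere (0 : E) 1 × Ioi (0 : ℝ) => g ((q.2 : ℝ) • (q.1 : E))) ∘
        homeomorphUnitSphereProd E = g ∘ Subtype.val := by
      ext x
      simp only [Function.comp_apply, homeomorphUnitSphereProd_apply_snd_coe,
        homeomorphUnitSphereProd_apply_fst_coe, smul_smul]
      rw [mul_inv_cancel₀ (norm_ne_zero_iff.2 x.2), one_smul]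
    rw [h1, ← integrableOn_iff_comap_subtypeVal (by measurability), IntegrableOn,
      restrict_compl_singleton]
  have hnorm : ∀ q : sphere (0 : E) 1 × Ioi (0 : ℝ), ‖(q.2 : ℝ) • (q.1 : E)‖ = q.2 := fun q => by
    rw [norm_smul, norm_eq_of_mem_sphere, mul_one, Real.norm_of_nonneg (le_of_lt q.2.2)]
  have hmeas : Measurable fun q : sphere (0 : E) 1 × Ioi (0 : ℝ) =>
      Φ ((q.2 : ℝ) • (q.1 : E)) * w q.2 := by
    have := hΦ.measurable
    fun_prop
  have hsph : ∀ r : ℝ, Integrable (fun ω : sphere (0 : E) 1 => Φ (r • (ω : E))) μ.toSphere :=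
    fun r => (by fun_prop : Continuous fun ω : sphere (0 : E) 1 => Φ (r • (ω : E))
      ).integrable_of_hasCompactSupport (HasCompactSupport.of_compactSpace _)
  rw [polar] at hv ⊢
  simp only [hnorm] at hv ⊢
  have : NeZero μ.toSphere := ⟨μ.toSphere_ne_zero⟩
  have hv' : Integrable (fun r : Ioi (0 : ℝ) => v r)
      (Measure.volumeIoiPow (Module.finrank ℝ E - 1)) := by
    refine (Integrable.comp_snd_iff (β := Ioi (0 : ℝ)) (f := fun r : Ioi (0 : ℝ) => v r) ?_).1 hv
    exact NeZero.ne _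
  rw [integrable_prod_iff' hmeas.aestronglyMeasurable]
  refine ⟨Filter.Eventually.of_forall fun r => (hsph r).mul_const (w r), hv'.mono' ?_ ?_⟩
  · exact hmeas.norm.stronglyMeasurable.integral_prod_left'.aestronglyMeasurable
  · refine Filter.Eventually.of_forall fun r => ?_
    rw [Real.norm_of_nonneg (integral_nonneg fun _ => norm_nonneg _)]
    simp only [Real.norm_of_nonneg (mul_nonneg (hΦ0 _) (hw0 _))]
    rw [integral_mul_const]
    exact h r r.2

section spectral

variable {n : ℕ} {f : EuclideanSpace ℝ (Fin n) → ℂ}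

open FourierTransform in
lemma fourierHat_eq_fourier (f : EuclideanSpace ℝ (Fin n) → ℂ) (ξ : EuclideanSpace ℝ (Fin n)) :
    fourierHat f ξ =
      ((2 * Real.pi) ^ (-(n : ℝ) / 2) : ℝ) * 𝓕 f ((2 * Real.pi)⁻¹ • ξ) := by
  rw [fourierHat, Real.fourier_eq']
  congr 2
  ext x
  rw [smul_eq_mul, mul_comm]
  congr 2
  rw [inner_smul_right]
  have := Real.pi_ne_zero
  have : -2 * Real.pi * ((2 * Real.pi)⁻¹ * ⟪x, ξ⟫) = - ⟪x, ξ⟫ := by field_simp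
  rw [this]
  push_cast
  ring

open FourierTransform in
lemma continuous_fourier_of_integrable (hf : Integrable f) : Continuous (𝓕 f) :=
  VectorFourier.fourierIntegral_continuous Real.continuous_fourierChar
    (by exact continuous_inner) hf

lemma continuous_fourierHat (hf : Integrable f) : Continuous (fourierHat f) := by
  have h : fourierHat f = fun ξ => _ := funext (fourierHat_eq_fourier f)
  rw [h]
  have := continuous_fourier_of_integrable hf
  fun_prop

open ComplexConjugate in
/-- The pairing of `f` with its spectral projection is the spherical mean square of `f̂`. -/
lemma integral_mul_conj_spectralProj (hf : Integrable f) (lam : ℝ) :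
    ∫ x, f x * conj (spectralProj f lam x) =
      ((∫ ω : sphere (0 : EuclideanSpace ℝ (Fin n)) 1,
        ‖fourierHat f (lam • (ω : EuclideanSpace ℝ (Fin n)))‖ ^ 2
        ∂((volume : Measure (EuclideanSpace ℝ (Fin n))).toSphere) : ℝ) : ℂ) := by
  set σ := (volume : Measure (EuclideanSpace ℝ (Fin n))).toSphere
  set c : ℂ := (((2 * Real.pi) ^ (-(n : ℝ) / 2) : ℝ) : ℂ) with hc
  set k : EuclideanSpace ℝ (Fin n) → sphere (0 : EuclideanSpace ℝ (Fin n)) 1 → ℂ := fun x ω =>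
    f x * conj (fourierHat f (lam • (ω : EuclideanSpace ℝ (Fin n)))) *
      Complex.exp (((-(lam * ⟪x, (ω : EuclideanSpace ℝ (Fin n))⟫) : ℝ) : ℂ) * Complex.I) with hk
  have hcont := continuous_fourierHat hf
  have hgc : Continuous fun ω : sphere (0 : EuclideanSpace ℝ (Fin n)) 1 =>
      conj (fourierHat f (lam • (ω : EuclideanSpace ℝ (Fin n)))) :=
    Complex.continuous_conj.comp (by fun_prop)
  have hgi := hgc.integrable_of_hasCompactSupport (μ := σ) (HasCompactSupport.of_compactSpace _)
  have hki : Integrable (Function.uncurry k) (volume.prod σ) := by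
    have h1 := hf.mul_prod hgi
    refine h1.mono (h1.aestronglyMeasurable.mul (Continuous.aestronglyMeasurable (by fun_prop)))
      (Filter.Eventually.of_forall fun q => ?_)
    simp only [Function.uncurry_def, hk, norm_mul, Complex.norm_exp_ofReal_mul_I, mul_one, le_refl]
  have hl : ∀ x, f x * conj (spectralProj f lam x) = c * ∫ ω, k x ω ∂σ := by
    intro x
    rw [spectralProj, map_mul, Complex.conj_ofReal, ← integral_conj, mul_left_comm,
      ← integral_const_mul]
    congr 2
    ext ω
    simp only [hk, map_mul, ← Complex.exp_conj, Complex.conj_I, Complex.conj_ofReal]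
    rw [← mul_assoc]
    congr 2
    push_cast
    ring
  have hr : ∀ ω : sphere (0 : EuclideanSpace ℝ (Fin n)) 1, c * ∫ x, k x ω =
      ((‖fourierHat f (lam • (ω : EuclideanSpace ℝ (Fin n)))‖ ^ 2 : ℝ) : ℂ) := by
    intro ω
    rw [Complex.ofReal_pow, ← Complex.mul_conj']
    conv_rhs => rw [fourierHat]
    rw [mul_assoc, ← integral_mul_const]
    congr 2
    ext x
    simp only [hk]
    rw [mul_right_comm, inner_smul_right]
    congr 3
    push_cast
    ring
  simp_rw [hl]
  rw [integral_const_mul, integral_integral_swap hki, ← integral_const_mul]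
  simp_rw [hr]
  exact integral_ofReal

end spectral

section approximation

variable {n : ℕ} {f : EuclideanSpace ℝ (Fin n) → ℂ} {θ : ℝ → ℝ}

lemma measurable_comp_norm_of_antitoneOn {E : Type*} [NormedAddCommGroup E] [MeasurableSpace E]
    [OpensMeasurableSpace E] (hθ : AntitoneOn θ (Ici 0)) : Measurable fun x : E => θ ‖x‖ := by
  have h1 : Antitone fun t => θ (max 0 t) := fun s t hst =>
    hθ (le_max_left 0 s) (le_max_left 0 t) (max_le_max le_rfl hst)
  have h2 : (fun x : E => θ ‖x‖) = (fun t => θ (max 0 t)) ∘ norm := by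
    ext x
    simp
  rw [h2]
  exact h1.measurable.comp measurable_norm

open FourierTransform in
lemma integrable_norm_fourier_sq_mul_exp (hn : 1 ≤ n) (hf : Integrable f)
    (hθ : AntitoneOn θ (Ici 0)) {D : ℝ}
    (hD : ∀ lam : ℝ, 0 < lam → ∫ ω : sphere (0 : EuclideanSpace ℝ (Fin n)) 1,
      ‖fourierHat f (lam • (ω : EuclideanSpace ℝ (Fin n)))‖ ^ 2
      ∂((volume : Measure (EuclideanSpace ℝ (Fin n))).toSphere) ≤
        D * Real.exp (-(lam * θ lam))) :
    Integrable fun ξ : EuclideanSpace ℝ (Fin n) => ‖𝓕 f ξ‖ ^ 2 *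
      (Real.exp (‖(2 * Real.pi) • ξ‖ * θ ‖(2 * Real.pi) • ξ‖) *
        ((1 + ‖(2 * Real.pi) • ξ‖) ^ (n + 1))⁻¹) := by
  have : NeZero n := ⟨by omega⟩
  have h1 : Antitone fun t => θ (max 0 t) := fun s t hst =>
    hθ (le_max_left 0 s) (le_max_left 0 t) (max_le_max le_rfl hst)
  have hcont := continuous_fourierHat hf
  have h1m := h1.measurable
  have hv : Integrable fun x : EuclideanSpace ℝ (Fin n) => D * ((1 + ‖x‖) ^ (n + 1))⁻¹ := by
    have h2 := integrable_one_add_norm (E := EuclideanSpace ℝ (Fin n)) (μ := volume)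
      (r := (n + 1 : ℕ)) (by simp)
    refine (h2.congr (Filter.Eventually.of_forall fun x => ?_)).const_mul D
    simp only
    rw [Real.rpow_neg (by positivity), Real.rpow_natCast]
  have hG := integrable_mul_comp_norm (volume : Measure (EuclideanSpace ℝ (Fin n)))
    (Φ := fun ξ => ‖fourierHat f ξ‖ ^ 2) (by fun_prop) (fun x => by positivity)
    (w := fun r => Real.exp (r * θ (max 0 r)) * ((1 + |r|) ^ (n + 1))⁻¹)
    (v := fun r => D * ((1 + |r|) ^ (n + 1))⁻¹)
    ((measurable_id.mul h1m).exp.mul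
      (by fun_prop : Measurable fun r : ℝ => (1 + |r|) ^ (n + 1)).inv) (fun r => by positivity)
    (by simpa using hv) (fun r hr => by
      rw [max_eq_right hr.le, ← mul_assoc]
      refine mul_le_mul_of_nonneg_right ?_ (by positivity)
      have h3 := mul_le_mul_of_nonneg_right (hD r hr) (Real.exp_pos (r * θ r)).le
      rwa [mul_assoc D, ← Real.exp_add, neg_add_cancel, Real.exp_zero, mul_one] at h3)
  have hpi : (2 * Real.pi) ≠ 0 := by positivity
  have hc : (0 : ℝ) < (2 * Real.pi) ^ (-(n : ℝ) / 2) := by positivity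
  refine ((hG.comp_smul hpi).const_mul (((2 * Real.pi) ^ (-(n : ℝ) / 2)) ^ 2)⁻¹).congr
    (Filter.Eventually.of_forall fun ξ => ?_)
  simp only [fourierHat_eq_fourier, smul_smul, inv_mul_cancel₀ hpi, one_smul, norm_mul,
    Complex.norm_real, Real.norm_of_nonneg hc.le, abs_norm, max_eq_right (norm_nonneg _)]
  rw [mul_pow]
  field_simp

open FourierTransform Convolution ContinuousLinearMap in
/-- All mollifications at scale smaller than `r` of a function `f` vanishing on the ball of radius
`r` are zero, if `𝓕 f` is square integrable against `exp (rθ(r))` up to a polynomial factor. -/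
lemma normed_convolution_eq_zero (hf : Integrable f) {r : ℝ} (hr : ∀ x, ‖x‖ < r → f x = 0)
    (hθ : ∀ t : ℝ, 0 ≤ t → 0 < θ t) (hθ' : AntitoneOn θ (Ici 0))
    (hdiv : ¬ IntegrableOn (fun t : ℝ => θ t / t) (Ici 1))
    (hG : Integrable fun ξ : EuclideanSpace ℝ (Fin n) => ‖𝓕 f ξ‖ ^ 2 *
      (Real.exp (‖(2 * Real.pi) • ξ‖ * θ ‖(2 * Real.pi) • ξ‖) *
        ((1 + ‖(2 * Real.pi) • ξ‖) ^ (n + 1))⁻¹))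
    (φ : ContDiffBump (0 : EuclideanSpace ℝ (Fin n))) (hφ : φ.rOut < r)
    (x : EuclideanSpace ℝ (Fin n)) :
    (φ.normed volume ⋆[lsmul ℝ ℝ, volume] f) x = 0 := by
  set S : SchwartzMap (EuclideanSpace ℝ (Fin n)) ℂ :=
    HasCompactSupport.toSchwartzMap (f := fun x => (φ.normed volume x : ℂ))
      (φ.hasCompactSupport_normed.comp_left (g := fun x : ℝ => (x : ℂ)) (by simp))
      (Complex.ofRealCLM.contDiff.comp φ.contDiff_normed) with hS
  have hconv : (φ.normed volume ⋆[lsmul ℝ ℝ, volume] f) = (S ⋆[lsmul ℂ ℂ, volume] f) := by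
    ext y
    simp only [convolution_def, lsmul_apply, Complex.real_smul, smul_eq_mul]
    rfl
  have hF : ∀ ξ, 𝓕 (φ.normed volume ⋆[lsmul ℝ ℝ, volume] f) ξ = 𝓕 S ξ * 𝓕 f ξ := fun ξ => by
    rw [hconv, Real.fourier_smul_convolution_eq S.integrable hf, smul_eq_mul,
      SchwartzMap.fourier_coe]
  have hcont : Continuous (φ.normed volume ⋆[lsmul ℝ ℝ, volume] f) :=
    φ.hasCompactSupport_normed.continuous_convolution_left _ φ.continuous_normed
      hf.locallyIntegrable
  have hint : Integrable (φ.normed volume ⋆[lsmul ℝ ℝ, volume] f) :=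
    φ.integrable_normed.integrable_convolution _ hf
  refine eq_zero_of_integrable_fourier_mul_exp hcont hint (sub_pos.2 hφ) (fun y hy => ?_) hθ hθ'
    hdiv ?_ x
  · have hy' : ‖y‖ < r := hy.trans_le (sub_le_self r φ.rOut_pos.le)
    rw [φ.normed_convolution_eq_right, hr y hy']
    intro z hz
    rw [hr y hy', hr z]
    have := norm_le_norm_add_norm_sub' z y
    rw [mem_ball, dist_eq_norm] at hz
    linarith
  obtain ⟨A, hA0, hA⟩ : ∃ A : ℝ, 0 ≤ A ∧
      ∀ ξ, ‖𝓕 S ξ‖ ≤ A * ((1 + ‖(2 * Real.pi) • ξ‖) ^ (n + 1))⁻¹ := by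
    refine ⟨2 ^ (n + 1) * ((Finset.Iic (n + 1, 0)).sup fun m => SchwartzMap.seminorm ℝ m.1 m.2)
      (𝓕 S) * 7 ^ (n + 1), by positivity, fun ξ => ?_⟩
    have h1 := SchwartzMap.one_add_le_sup_seminorm_apply (𝕜 := ℝ) (m := (n + 1, 0)) le_rfl le_rfl
      (𝓕 S) ξ
    rw [norm_iteratedFDeriv_zero] at h1
    rw [← div_eq_mul_inv, le_div_iff₀ (by positivity)]
    have h2 : 1 + ‖(2 * Real.pi) • ξ‖ ≤ 7 * (1 + ‖ξ‖) := by
      rw [norm_smul, Real.norm_of_nonneg (by positivity)]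
      nlinarith [Real.pi_lt_d2, norm_nonneg ξ]
    calc ‖𝓕 S ξ‖ * (1 + ‖(2 * Real.pi) • ξ‖) ^ (n + 1)
        ≤ ‖𝓕 S ξ‖ * (7 * (1 + ‖ξ‖)) ^ (n + 1) := by gcongr
      _ = (1 + ‖ξ‖) ^ (n + 1) * ‖𝓕 S ξ‖ * 7 ^ (n + 1) := by rw [mul_pow]; ring
      _ ≤ _ := by gcongr
  have hmeas : Measurable fun ξ : EuclideanSpace ℝ (Fin n) => θ ‖(2 * Real.pi) • ξ‖ :=
    (measurable_comp_norm_of_antitoneOn hθ').comp (measurable_const_smul (2 * Real.pi))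
  have hFcont := (continuous_fourier_of_integrable hint).measurable
  refine ((𝓕 S).integrable.norm.add (hG.const_mul A)).mono'
    (hFcont.norm.mul (((by fun_prop : Measurable fun ξ : EuclideanSpace ℝ (Fin n) =>
      ‖(2 * Real.pi) • ξ‖).mul hmeas).div_const 2).exp).aestronglyMeasurable
    (Filter.Eventually.of_forall fun ξ => ?_)
  rw [Real.norm_of_nonneg (by positivity), hF, norm_mul]
  set a := Real.exp (‖(2 * Real.pi) • ξ‖ * θ ‖(2 * Real.pi) • ξ‖ / 2) with ha
  have ha2 : Real.exp (‖(2 * Real.pi) • ξ‖ * θ ‖(2 * Real.pi) • ξ‖) = a ^ 2 := by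
    rw [ha, ← Real.exp_nat_mul]
    congr 1
    push_cast
    ring
  have h1 := hA ξ
  simp only [Pi.add_apply, ha2]
  have h2 : ‖𝓕 f ξ‖ * a ≤ 1 + ‖𝓕 f ξ‖ ^ 2 * a ^ 2 := by
    nlinarith [sq_nonneg (‖𝓕 f ξ‖ * a - 1)]
  calc ‖𝓕 S ξ‖ * ‖𝓕 f ξ‖ * a = ‖𝓕 S ξ‖ * (‖𝓕 f ξ‖ * a) := by ring
    _ ≤ ‖𝓕 S ξ‖ * (1 + ‖𝓕 f ξ‖ ^ 2 * a ^ 2) := by gcongr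
    _ = ‖𝓕 S ξ‖ + ‖𝓕 S ξ‖ * (‖𝓕 f ξ‖ ^ 2 * a ^ 2) := by ring
    _ ≤ ‖𝓕 S ξ‖ + A * ((1 + ‖(2 * Real.pi) • ξ‖) ^ (n + 1))⁻¹ * (‖𝓕 f ξ‖ ^ 2 * a ^ 2) := by
      gcongr
    _ = _ := by ring

end approximation

theorem stmt_18 {n : ℕ} (hn : 1 ≤ n)
    (f : EuclideanSpace ℝ (Fin n) → ℂ) (hf : Integrable f)
    (V : Set (EuclideanSpace ℝ (Fin n))) (hV_open : IsOpen V) (hV_zero : (0 : _) ∈ V)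
    (hvanish : ∀ x ∈ V, f x = 0)
    (θ : ℝ → ℝ)
    (hθ_pos : ∀ t : ℝ, 0 ≤ t → 0 < θ t)
    (hθ_anti : AntitoneOn θ (Ici 0))
    (hθ_lim : Tendsto θ atTop (nhds 0))
    (hθ_div : ¬ IntegrableOn (fun t : ℝ => θ t / t) (Ici 1))
    (C : ℝ) (hC : 0 < C)
    (hdecay : ∀ lam : ℝ, 0 < lam → ∀ x ∉ V,
      ‖spectralProj f lam x‖ ≤ C * Real.exp (-lam * θ lam)) :
    ∀ᵐ x : EuclideanSpace ℝ (Fin n), f x = 0 := by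
  obtain ⟨r, hr, hrV⟩ := Metric.isOpen_iff.1 hV_open 0 hV_zero
  have hr0 : ∀ x, ‖x‖ < r → f x = 0 := fun x hx => hvanish x (hrV (by simpa using hx))
  have hG := integrable_norm_fourier_sq_mul_exp hn hf hθ_anti (D := (∫ x, ‖f x‖) * C)
    fun lam hlam => by
      rw [← Real.norm_of_nonneg (integral_nonneg fun ω => sq_nonneg _), ← Complex.norm_real,
        ← integral_mul_conj_spectralProj hf, mul_assoc, ← integral_mul_const]
      refine norm_integral_le_of_norm_le (hf.norm.mul_const _)
        (Filter.Eventually.of_forall fun x => ?_)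
      rw [norm_mul, RCLike.norm_conj]
      by_cases hx : x ∈ V
      · simp [hvanish x hx]
      · rw [← neg_mul]
        exact mul_le_mul_of_nonneg_left (hdecay lam hlam x hx) (norm_nonneg _)
  have hpos : ∀ i : ℕ, 0 < r / 2 / (i + 2) := fun i => by positivity
  set φ : ℕ → ContDiffBump (0 : EuclideanSpace ℝ (Fin n)) := fun i =>
    ⟨r / 2 / (i + 2), r / (i + 2), hpos i, by
      have := hpos i
      have h2 : r / (i + 2) = 2 * (r / 2 / (i + 2)) := by ring
      linarith⟩ with hφ
  have hlim := ContDiffBump.ae_convolution_tendsto_right_of_locallyIntegrable (φ := φ)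
    (l := atTop) (K := 2) (μ := volume) (g := f) ?_
    (Filter.Eventually.of_forall fun i => le_of_eq ?_) hf.locallyIntegrable
  · filter_upwards [hlim] with x hx
    refine tendsto_nhds_unique hx (tendsto_const_nhds.congr fun i => ?_)
    refine (normed_convolution_eq_zero hf hr0 hθ_pos hθ_anti hθ_div hG (φ i) ?_ x).symm
    have hi : (0 : ℝ) ≤ i := i.cast_nonneg
    exact div_lt_self hr (by linarith)
  · exact tendsto_const_nhds.div_atTop
      (tendsto_atTop_add_const_right _ _ tendsto_natCast_atTop_atTop)
  · simp only [hφ]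
    ring
end

section
/- Let θ be a positive decreasing function on [0,∞) vanishing at infinity with ∫₁^∞ θ(t)/t dt = ∞. If f ∈ L¹(ℝⁿ) vanishes on a nonempty open set and its Fourier transform satisfies |f̂(ξ)| ≤ C e^{-|ξ|θ(|ξ|)} for all ξ ∈ ℝⁿ, then f = 0. -/
open MeasureTheory Set Filter
open scoped RealInnerProductSpace

lemma sum_partial_weighted_sum_div (a : ℕ → ℝ) (N : ℕ) :
    ∑ k ∈ Finset.range N, (∑ j ∈ Finset.range (k + 1), (j + 1) * a j) / ((k + 1) * (k + 2)) =
      ∑ j ∈ Finset.range N, a j - (∑ j ∈ Finset.range N, (j + 1) * a j) / (N + 1) := by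
  induction N with
  | zero => simp
  | succ N ih =>
    rw [Finset.sum_range_succ, ih, Finset.sum_range_succ _ N, Finset.sum_range_succ _ N]
    push_cast
    field_simp
    ring

/-- The geometric means of a nonnegative sequence are bounded by averages of `j ↦ (j + 1) * a j`. -/
lemma le_weighted_average_of_pow_le_prod {a : ℕ → ℝ} (ha : ∀ j, 0 ≤ a j) {x : ℝ} (hx : 0 ≤ x)
    {k : ℕ} (h : x ^ (k + 1) ≤ ∏ j ∈ Finset.range (k + 1), a j) :
    x ≤ 2 * Real.exp 1 *
      ((∑ j ∈ Finset.range (k + 1), (j + 1) * a j) / ((k + 1) * (k + 2))) := by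
  set n := k + 1 with hn
  set S := ∑ j ∈ Finset.range n, ((j : ℝ) + 1) * a j
  have hS : 0 ≤ S := Finset.sum_nonneg fun j _ => mul_nonneg (by positivity) (ha j)
  have hn0 : (0 : ℝ) < n := by rw [hn]; positivity
  have amgm : ∏ j ∈ Finset.range n, (((j : ℝ) + 1) * a j) ≤ (S / n) ^ n := by
    have := Real.geom_mean_le_arith_mean (Finset.range n) (fun _ => (1 : ℝ))
      (fun j => ((j : ℝ) + 1) * a j) (fun _ _ => zero_le_one) (by simpa using hn0)
      (fun j _ => mul_nonneg (by positivity) (ha j))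
    simp only [Real.rpow_one, Finset.sum_const, Finset.card_range, nsmul_eq_mul, mul_one,
      one_mul] at this
    have hP : 0 ≤ ∏ j ∈ Finset.range n, (((j : ℝ) + 1) * a j) :=
      Finset.prod_nonneg fun j _ => mul_nonneg (by positivity) (ha j)
    calc _ = ((∏ j ∈ Finset.range n, (((j : ℝ) + 1) * a j)) ^ ((n : ℝ)⁻¹)) ^ n := by
          rw [← Real.rpow_natCast, ← Real.rpow_mul hP, inv_mul_cancel₀ hn0.ne', Real.rpow_one]
      _ ≤ _ := by gcongr
  have hfac : ∏ j ∈ Finset.range n, ((j : ℝ) + 1) = (n.factorial : ℝ) := by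
    rw [← Finset.prod_range_add_one_eq_factorial]; push_cast; rfl
  rw [Finset.prod_mul_distrib, hfac] at amgm
  have hexp : (n : ℝ) ^ n ≤ Real.exp 1 ^ n * n.factorial := by
    have := Real.pow_div_factorial_le_exp (n : ℝ) hn0.le n
    rw [div_le_iff₀ (by positivity)] at this
    rwa [← Real.exp_nat_mul, mul_one]
  have key : (n * x) ^ n ≤ (Real.exp 1 * (S / n)) ^ n := by
    calc (n * x) ^ n = (n : ℝ) ^ n * x ^ n := mul_pow _ _ _
      _ ≤ (Real.exp 1 ^ n * n.factorial) * ∏ j ∈ Finset.range n, a j := by gcongr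
      _ = Real.exp 1 ^ n * (n.factorial * ∏ j ∈ Finset.range n, a j) := by ring
      _ ≤ Real.exp 1 ^ n * (S / n) ^ n := by gcongr
      _ = _ := (mul_pow _ _ _).symm
  have key' := le_of_pow_le_pow_left₀ (by omega) (by positivity) key
  have hn' : (n : ℝ) = k + 1 := by rw [hn]; push_cast; ring
  have h2 : x ≤ Real.exp 1 * S / ((k + 1) * (k + 1)) := by
    rw [le_div_iff₀ (by positivity)]
    rw [hn', ← mul_div_assoc, le_div_iff₀ (by positivity)] at key'
    linarith
  refine h2.trans ?_
  rw [← mul_div_assoc, div_le_div_iff₀ (by positivity) (by positivity)]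
  have : 0 ≤ Real.exp 1 * S := by positivity
  have hk : (0 : ℝ) ≤ k := by positivity
  nlinarith [mul_nonneg this (mul_nonneg hk (by positivity : (0 : ℝ) ≤ k + 1))]

/-- A form of **Carleman's inequality**: if `a` is summable and `b` is dominated by the geometric
means of `a`, then `b` is summable. -/
lemma Summable.of_pow_le_prod {a b : ℕ → ℝ} (ha : ∀ j, 0 ≤ a j) (hb : ∀ k, 0 ≤ b k)
    (h : ∀ k, b k ^ (k + 1) ≤ ∏ j ∈ Finset.range (k + 1), a j) (hs : Summable a) :
    Summable b := by
  refine summable_of_sum_range_le (c := 2 * Real.exp 1 * ∑' j, a j) hb fun N => ?_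
  calc ∑ k ∈ Finset.range N, b k
      ≤ ∑ k ∈ Finset.range N, 2 * Real.exp 1 *
        ((∑ j ∈ Finset.range (k + 1), (j + 1) * a j) / ((k + 1) * (k + 2))) :=
        Finset.sum_le_sum fun k _ => le_weighted_average_of_pow_le_prod ha (hb k) (h k)
    _ = 2 * Real.exp 1 * (∑ j ∈ Finset.range N, a j -
        (∑ j ∈ Finset.range N, (j + 1) * a j) / (N + 1)) := by
        rw [← Finset.mul_sum, sum_partial_weighted_sum_div]
    _ ≤ 2 * Real.exp 1 * ∑' j, a j := by
        gcongr
        refine (sub_le_self _ ?_).trans (hs.sum_le_tsum _ fun j _ => ha j)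
        exact div_nonneg (Finset.sum_nonneg fun j _ => mul_nonneg (by positivity) (ha j))
          (by positivity)

section Bang

variable {F : Type*} [NormedAddCommGroup F] [NormedSpace ℝ F] {g : ℕ → ℝ → F} {M : ℕ → ℝ}

/-- One step of **Bang's argument**: if the derivatives of order at most `N + 1` are small at `x`,
then those of order at most `N` are still fairly small at distance `M N / (e * M (N + 1))`. -/
lemma bang_step_s19 (hM : ∀ k, 0 < M k) (hmono : Monotone fun k => M (k + 1) / M k)
    (hg : ∀ k t, HasDerivAt (g k) (g (k + 1) t) t) (hbd : ∀ k t, ‖g k t‖ ≤ M k) {N : ℕ} {x s : ℝ}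
    (hx : ∀ j ≤ N + 1, ‖g j x‖ ≤ Real.exp (j - (N + 1 : ℕ)) * M j)
    (hs : 0 ≤ s) (hs' : s ≤ M N / M (N + 1) / Real.exp 1) :
    ∀ j ≤ N, ‖g j (x + s)‖ ≤ Real.exp (j - N) * M j := by
  set m := M (N + 1) / M N with hm
  have hm0 : 0 < m := div_pos (hM _) (hM _)
  have grow : ∀ i ≤ N + 1, ∀ r, 0 ≤ r → ‖g (N + 1 - i) (x + r)‖ ≤
      Real.exp ((N + 1 - i : ℕ) - (N + 1 : ℕ)) * M (N + 1 - i) *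
        Real.exp (Real.exp 1 * m * r) := by
    intro i
    induction i with
    | zero =>
      intro _ r hr
      simp only [Nat.sub_zero, sub_self, Real.exp_zero, one_mul]
      refine (hbd _ _).trans (le_mul_of_one_le_right (hM _).le (Real.one_le_exp ?_))
      positivity
    | succ i ih =>
      intro hi r hr
      obtain ⟨j, hj⟩ : ∃ j, N + 1 - (i + 1) = j := ⟨_, rfl⟩
      have hj' : N + 1 - i = j + 1 := by omega
      have hjN : j ≤ N := by omega
      specialize ih (by omega)
      rw [hj'] at ih
      rw [hj]
      set K := Real.exp ((j : ℕ) - (N + 1 : ℕ)) * M j with hK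
      refine image_norm_le_of_norm_deriv_right_le_deriv_boundary (f := fun r => g j (x + r))
        (f' := fun r => g (j + 1) (x + r)) (a := 0) (b := r)
        (B := fun r => K * Real.exp (Real.exp 1 * m * r))
        (B' := fun r => K * (Real.exp (Real.exp 1 * m * r) * (Real.exp 1 * m))) ?_ ?_ ?_ ?_ ?_
        (right_mem_Icc.2 hr)
      · exact fun r _ => ((hg j (x + r)).comp_const_add x r).continuousAt.continuousWithinAt
      · exact fun r _ => ((hg j (x + r)).comp_const_add x r).hasDerivWithinAt
      · simpa [hK] using hx j (by omega)
      · intro r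
        have := ((hasDerivAt_id r).const_mul (Real.exp 1 * m)).exp.const_mul K
        simpa using this
      · intro r hr
        refine (ih r hr.1).trans ?_
        have h1 : M (j + 1) ≤ M j * m := by
          have := hmono hjN
          simp only at this
          rw [div_le_iff₀ (hM _)] at this
          linarith
        have h2 : Real.exp (((j + 1 : ℕ) : ℝ) - (N + 1 : ℕ)) =
            Real.exp ((j : ℝ) - (N + 1 : ℕ)) * Real.exp 1 := by
          rw [← Real.exp_add]; congr 1; push_cast; ring
        rw [h2, hK]
        calc _ ≤ Real.exp ((j : ℝ) - (N + 1 : ℕ)) * Real.exp 1 * (M j * m) *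
              Real.exp (Real.exp 1 * m * r) := by gcongr
          _ = _ := by ring
  intro j hj
  have := grow (N + 1 - j) (by omega) s hs
  rw [Nat.sub_sub_self (by omega)] at this
  refine this.trans ?_
  have h1 : Real.exp 1 * m * s ≤ 1 := by
    rw [le_div_iff₀ (Real.exp_pos 1), le_div_iff₀ (hM _)] at hs'
    rw [hm, ← mul_div_assoc, div_mul_eq_mul_div, div_le_one (hM _)]
    linarith
  calc _ ≤ Real.exp ((j : ℝ) - (N + 1 : ℕ)) * M j * Real.exp 1 := by
        have := hM j
        gcongr
    _ = _ := by
        rw [mul_right_comm, ← Real.exp_add]; congr 2; push_cast; ring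

/-- **Bang's form of the Denjoy–Carleman theorem** for log-convex bounds. -/
lemma eq_zero_of_not_summable_ratio (hM : ∀ k, 0 < M k)
    (hmono : Monotone fun k => M (k + 1) / M k)
    (hg : ∀ k t, HasDerivAt (g k) (g (k + 1) t) t) (hbd : ∀ k t, ‖g k t‖ ≤ M k)
    (hdiv : ¬ Summable fun k => M k / M (k + 1)) (h0 : ∀ k, g k 0 = 0) {t : ℝ} (ht : 0 ≤ t) :
    g 0 t = 0 := by
  have hpos : ∀ k, 0 < M k / M (k + 1) / Real.exp 1 := fun k =>
    div_pos (div_pos (hM _) (hM _)) (Real.exp_pos 1)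
  have travel : ∀ L N : ℕ, ∀ x s : ℝ,
      (∀ j ≤ N + L, ‖g j x‖ ≤ Real.exp (j - (N + L : ℕ)) * M j) → 0 ≤ s →
      s ≤ ∑ i ∈ Finset.range L, M (N + i) / M (N + i + 1) / Real.exp 1 →
      ∀ j ≤ N, ‖g j (x + s)‖ ≤ Real.exp (j - N) * M j := by
    intro L
    induction L with
    | zero =>
      intro N x s hx hs hs'
      obtain rfl : s = 0 := le_antisymm (by simpa using hs') hs
      simpa using hx
    | succ L ih =>
      intro N x s hx hs hs'
      rw [Finset.sum_range_succ] at hs'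
      set d := M (N + L) / M (N + L + 1) / Real.exp 1
      have hd : 0 < d := hpos (N + L)
      have hstep := bang_step_s19 hM hmono hg hbd (N := N + L) (x := x) (s := min s d) hx
        (le_min hs hd.le) (min_le_right _ _)
      have := ih N (x + min s d) (s - min s d) hstep (sub_nonneg.2 (min_le_left _ _)) ?_
      · simpa using this
      · rcases le_total s d with h | h
        · rw [min_eq_left h, sub_self]
          exact Finset.sum_nonneg fun i _ => (hpos (N + i)).le
        · rw [min_eq_right h]; linarith
  have small : ∀ N : ℕ, ‖g 0 t‖ ≤ Real.exp (-N) * M 0 := by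
    intro N
    have hdiv' : ¬ Summable fun i => M (N + i) / M (N + i + 1) / Real.exp 1 := by
      intro h
      apply hdiv
      rw [← summable_nat_add_iff N]
      refine (h.mul_right (Real.exp 1)).congr fun i => ?_
      rw [div_mul_cancel₀ _ (Real.exp_pos 1).ne', add_comm N i]
    rw [not_summable_iff_tendsto_nat_atTop_of_nonneg fun i => (hpos (N + i)).le] at hdiv'
    obtain ⟨L, hL⟩ := (hdiv'.eventually_ge_atTop t).exists
    have := travel L N 0 t (fun j _ => by
      rw [h0, norm_zero]; exact mul_nonneg (Real.exp_pos _).le (hM j).le) ht hL 0 (Nat.zero_le _)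
    simpa using this
  have lim : Tendsto (fun N : ℕ => Real.exp (-N) * M 0) atTop (nhds 0) := by
    have := (Real.tendsto_exp_neg_atTop_nhds_zero.comp tendsto_natCast_atTop_atTop).mul_const (M 0)
    simpa using this
  exact norm_le_zero_iff.1 (ge_of_tendsto' lim small)

/-- The **Denjoy–Carleman theorem** for a log-convex sequence of bounds with
`∑ M k ^ (-1 / k) = ∞`. -/
lemma eq_zero_of_denjoy_carleman (hM : ∀ k, 0 < M k)
    (hconv : ∀ k, M (k + 1) ^ 2 ≤ M k * M (k + 2))
    (hg : ∀ k t, HasDerivAt (g k) (g (k + 1) t) t) (hbd : ∀ k t, ‖g k t‖ ≤ M k)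
    {b : ℕ → ℝ} (hb : ∀ k, 0 ≤ b k) (hbM : ∀ k, M (k + 1) * b k ^ (k + 1) ≤ M 0)
    (hdiv : ¬ Summable b) (h0 : ∀ k, g k 0 = 0) {t : ℝ} (ht : 0 ≤ t) :
    g 0 t = 0 := by
  refine eq_zero_of_not_summable_ratio hM ?_ hg hbd (fun hs => hdiv ?_) h0 ht
  · refine monotone_nat_of_le_succ fun k => ?_
    rw [div_le_div_iff₀ (hM _) (hM _)]
    nlinarith [hconv k]
  · refine hs.of_pow_le_prod (fun j => (div_pos (hM _) (hM _)).le) hb fun k => ?_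
    have hprod : ∀ n, ∏ j ∈ Finset.range n, M j / M (j + 1) = M 0 / M n := by
      intro n
      induction n with
      | zero => simp [(hM 0).ne']
      | succ n ih =>
        rw [Finset.prod_range_succ, ih]
        have := (hM n).ne'
        have := (hM (n + 1)).ne'
        field_simp
    rw [hprod, le_div_iff₀ (hM _), mul_comm]
    exact hbM k

end Bang

/-- The divergence of `∫ θ t / t` in terms of a series along fourth powers. -/
lemma not_summable_of_not_integrableOn_div {θ : ℝ → ℝ} (hθ_pos : ∀ t, 0 ≤ t → 0 < θ t)
    (hθ_anti : AntitoneOn θ (Ici 0)) (hθ_div : ¬ IntegrableOn (fun t => θ t / t) (Ici 1))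
    {A : ℝ} (hA : 1 ≤ A) :
    ¬ Summable fun k : ℕ => θ (A * ((k : ℝ) + 1) ^ 4) / ((k : ℝ) + 1) := by
  intro hs
  have hA0 : 0 < A := by linarith
  apply hθ_div
  have h1 : IntegrableOn (fun s : ℝ => θ (A * s ^ 4) / s) (Ioi 1) := by
    have anti : AntitoneOn (fun s : ℝ => θ (A * s ^ 4) / s) (Ici ((1 : ℕ) : ℝ)) := by
      intro x hx y hy hxy
      simp only [Nat.cast_one, mem_Ici] at hx hy
      have hx0 : 0 < x := by linarith
      have hy0 : 0 < y := by linarith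
      have : θ (A * y ^ 4) ≤ θ (A * x ^ 4) :=
        hθ_anti (mem_Ici.2 (by positivity)) (mem_Ici.2 (by positivity)) (by gcongr)
      have := (hθ_pos (A * x ^ 4) (by positivity)).le
      simp only
      gcongr
    have := anti.integrableOn_Ioi_of_summable_comp_add (by simpa using hs) (fun t ht => by
      simp only [Nat.cast_one, mem_Ioi] at ht
      have ht0 : 0 < t := by linarith
      exact div_nonneg (hθ_pos _ (by positivity)).le ht0.le)
    simpa using this
  have h2 : IntegrableOn (fun t : ℝ => θ (A * t) / t) (Ioi 1) := by
    have := (integrableOn_Ioi_comp_rpow_iff'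
      ((Ioi (1 : ℝ)).indicator fun t : ℝ => θ (A * t) / t) (p := 4) (by norm_num)).1 ?_
    · rw [IntegrableOn, integrable_indicator_iff measurableSet_Ioi, IntegrableOn,
        Measure.restrict_restrict measurableSet_Ioi,
        inter_eq_left.2 (Ioi_subset_Ioi zero_le_one)] at this
      exact this
    · rw [← integrable_indicator_iff measurableSet_Ioi] at h1
      refine h1.integrableOn.congr_fun (fun x hx => ?_) measurableSet_Ioi
      have hx0 : 0 < x := hx
      have e : x ^ (4 : ℝ) = x ^ 4 := by exact_mod_cast Real.rpow_natCast x 4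
      have e3 : x ^ ((4 : ℝ) - 1) = x ^ 3 := by
        rw [← Real.rpow_natCast]; norm_num
      simp only [e, e3, indicator_apply, mem_Ioi, smul_eq_mul]
      have : 1 < x ^ 4 ↔ 1 < x := one_lt_pow_iff_of_nonneg hx0.le (by norm_num)
      simp only [this]
      split_ifs
      · field_simp
      · simp
  have h3 : IntegrableOn (fun t : ℝ => θ t / t) (Ioi A) := by
    have := (integrableOn_Ioi_comp_mul_left_iff (fun t : ℝ => θ t / t) 1 hA0).1 ?_
    · simpa using this
    · refine IntegrableOn.congr_fun (h2.div_const A) (fun x _ => ?_) measurableSet_Ioi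
      rw [div_div, mul_comm x]
  have h4 : IntegrableOn (fun t : ℝ => θ t / t) (Icc 1 A) := by
    refine AntitoneOn.integrableOn_isCompact isCompact_Icc fun x hx y hy hxy => ?_
    have hx0 : 0 < x := by linarith [hx.1]
    have hy0 : 0 < y := by linarith [hy.1]
    have := hθ_anti (mem_Ici.2 hx0.le) (mem_Ici.2 hy0.le) hxy
    have := (hθ_pos x hx0.le).le
    gcongr
  exact (h4.union h3).mono_set (by rw [Icc_union_Ioi_eq_Ici hA])

section Fourier

open scoped FourierTransform Convolution ContDiff

variable {E : Type*} [NormedAddCommGroup E] [InnerProductSpace ℝ E] [FiniteDimensional ℝ E]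
  [MeasurableSpace E] [BorelSpace E]

/-- The Fourier transform is injective on integrable functions. -/
lemma ae_eq_zero_of_fourier_eq_zero {f : E → ℂ} (hf : Integrable f) (h : ∀ w, 𝓕 f w = 0) :
    ∀ᵐ x, f x = 0 := by
  refine ae_eq_zero_of_integral_contDiff_smul_eq_zero hf.locallyIntegrable fun g hg hgc => ?_
  have hgc' : HasCompactSupport (fun x => (g x : ℂ)) := hgc.comp_left (g := Complex.ofReal) (by simp)
  have hg' : ContDiff ℝ ∞ fun x => (g x : ℂ) := Complex.ofRealCLM.contDiff.comp hg
  let φ : SchwartzMap E ℂ := hgc'.toSchwartzMap hg'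
  have hφ : ∀ x, φ x = g x := fun x => rfl
  have key := VectorFourier.integral_fourierIntegral_smul_eq_flip (L := innerₗ E)
    (f := f) (g := (𝓕⁻ φ : SchwartzMap E ℂ)) (μ := volume) (ν := volume)
    Real.continuous_fourierChar continuous_inner hf (𝓕⁻ φ : SchwartzMap E ℂ).integrable
  rw [flip_innerₗ] at key
  have h2 : ∀ x, VectorFourier.fourierIntegral Real.fourierChar volume (innerₗ E)
      (𝓕⁻ φ : SchwartzMap E ℂ) x = g x := by
    intro x
    change 𝓕 ((𝓕⁻ φ : SchwartzMap E ℂ) : E → ℂ) x = g x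
    rw [← SchwartzMap.fourier_coe, FourierTransform.fourier_fourierInv_eq, hφ]
  have h1 : ∀ w, VectorFourier.fourierIntegral Real.fourierChar volume (innerₗ E) f w = 0 := h
  simp only [h2, h1, zero_smul, integral_zero] at key
  rw [key]
  refine integral_congr_ae (Eventually.of_forall fun x => ?_)
  simp [mul_comm]

lemma norm_fourier_sub_one_le {ρ : E → ℝ} (hρ : Integrable ρ) (hpos : ∀ x, 0 ≤ ρ x)
    (hint : ∫ x, ρ x = 1) {ε : ℝ} (hsupp : ∀ x, ε < ‖x‖ → ρ x = 0) (w : E) :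
    ‖𝓕 (fun x => (ρ x : ℂ)) w - 1‖ ≤ 2 * Real.pi * ε * ‖w‖ := by
  have h1 : (1 : ℂ) = ∫ x, (ρ x : ℂ) := by rw [integral_complex_ofReal, hint]; simp
  have hρ' : Integrable fun x => (ρ x : ℂ) := hρ.ofReal
  have hi : Integrable fun x => Complex.exp (↑(-2 * Real.pi * ⟪x, w⟫) * Complex.I) • (ρ x : ℂ) := by
    have := (Real.fourierIntegral_convergent_iff (f := fun x => (ρ x : ℂ)) (μ := volume) w).2 hρ'
    simpa [Circle.smul_def, Real.fourierChar_apply] using this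
  rw [Real.fourier_eq', h1, ← integral_sub hi hρ']
  calc _ ≤ ∫ x, 2 * Real.pi * ε * ‖w‖ * ρ x := by
        refine norm_integral_le_of_norm_le (hρ.const_mul _) (Eventually.of_forall fun x => ?_)
        rw [smul_eq_mul, ← sub_one_mul, norm_mul, Complex.norm_real, Real.norm_of_nonneg (hpos x)]
        rcases lt_or_ge ε ‖x‖ with hx | hx
        · simp [hsupp x hx]
        · refine mul_le_mul_of_nonneg_right ?_ (hpos x)
          rw [mul_comm _ Complex.I]
          refine Real.norm_exp_I_mul_ofReal_sub_one_le.trans ?_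
          rw [norm_mul, Real.norm_eq_abs, abs_mul, abs_neg, abs_two, abs_of_pos Real.pi_pos,
            mul_assoc (2 * Real.pi)]
          refine mul_le_mul_of_nonneg_left ?_ (by positivity)
          exact (norm_inner_le_norm x w).trans (by gcongr)
    _ = _ := by rw [integral_const_mul, hint, mul_one]

/-- Mollifiers supported in small balls, with uniform control of their Fourier transforms. -/
lemma exists_mollifier_s19 (E : Type*) [NormedAddCommGroup E] [InnerProductSpace ℝ E]
    [FiniteDimensional ℝ E] [MeasurableSpace E] [BorelSpace E] :
    ∃ c : ℝ, 0 < c ∧ ∀ ε : ℝ, 0 < ε → ∃ ρ : E → ℂ, Integrable ρ ∧ (∀ x, ε < ‖x‖ → ρ x = 0) ∧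
      ∀ w, ‖𝓕 ρ w‖ ≤ 1 ∧ ε * ‖w‖ * ‖𝓕 ρ w‖ ≤ c ∧ ‖𝓕 ρ w - 1‖ ≤ 2 * Real.pi * ε * ‖w‖ := by
  let B : ContDiffBump (0 : E) := ⟨1 / 2, 1, by norm_num, by norm_num⟩
  let ρ₀ : E → ℝ := B.normed volume
  have hcd : ContDiff ℝ ∞ fun x => (ρ₀ x : ℂ) :=
    Complex.ofRealCLM.contDiff.comp (B.contDiff_normed (n := ⊤))
  have hcs : HasCompactSupport fun x => (ρ₀ x : ℂ) :=
    (B.hasCompactSupport_normed (μ := volume)).comp_left (g := Complex.ofReal) (by simp)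
  let φ : SchwartzMap E ℂ := hcs.toSchwartzMap hcd
  obtain ⟨c, hc, hφ⟩ := (𝓕 φ : SchwartzMap E ℂ).decay 1 0
  refine ⟨c, hc, fun ε hε => ?_⟩
  set n := Module.finrank ℝ E
  let ρ : E → ℝ := fun x => (ε ^ n)⁻¹ * ρ₀ (ε⁻¹ • x)
  have hρ : Integrable ρ :=
    ((integrable_comp_smul_iff volume ρ₀ (inv_ne_zero hε.ne')).2 B.integrable_normed).const_mul _
  have hpos : ∀ x, 0 ≤ ρ x := fun x => mul_nonneg (by positivity) (B.nonneg_normed _)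
  have hint : ∫ x, ρ x = 1 := by
    rw [integral_const_mul, Measure.integral_comp_inv_smul_of_nonneg _ _ hε.le, B.integral_normed,
      smul_eq_mul, mul_one, inv_mul_cancel₀ (by positivity)]
  have hsupp : ∀ x, ε < ‖x‖ → ρ x = 0 := by
    intro x hx
    have : ε⁻¹ • x ∉ Function.support ρ₀ := by
      rw [B.support_normed_eq, mem_ball_zero_iff, norm_smul, norm_inv, Real.norm_of_nonneg hε.le,
        not_lt, inv_mul_eq_div]
      exact ((one_le_div hε).2 hx.le)
    simp only [ρ, Function.notMem_support.1 this, mul_zero]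
  have hF : ∀ w, 𝓕 (fun x => (ρ x : ℂ)) w = (𝓕 φ : SchwartzMap E ℂ) (ε • w) := by
    intro w
    rw [SchwartzMap.fourier_coe, Real.fourier_eq', Real.fourier_eq']
    have := Measure.integral_comp_inv_smul_of_nonneg (volume : Measure E)
      (fun v => Complex.exp (↑(-2 * Real.pi * ⟪v, ε • w⟫) * Complex.I) • (ρ₀ v : ℂ)) hε.le
    have hcoe : ∀ v, φ v = (ρ₀ v : ℂ) := fun v => rfl
    simp only [hcoe]
    have h2 : ∫ v, Complex.exp (↑(-2 * Real.pi * ⟪v, w⟫) * Complex.I) • (ρ v : ℂ) =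
      (ε ^ n)⁻¹ • ∫ v, Complex.exp (↑(-2 * Real.pi * ⟪ε⁻¹ • v, ε • w⟫) * Complex.I) •
        (ρ₀ (ε⁻¹ • v) : ℂ) := by
      rw [← integral_smul]
      congr 1
      ext v
      rw [inner_smul_left, inner_smul_right]
      have : (starRingEnd ℝ) ε⁻¹ * (ε * ⟪v, w⟫) = ⟪v, w⟫ := by
        simp only [conj_trivial]
        field_simp
      rw [this]
      simp only [ρ, smul_eq_mul, Complex.real_smul]
      push_cast
      ring
    rw [h2, this, smul_smul, inv_mul_cancel₀ (by positivity), one_smul]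
  refine ⟨fun x => (ρ x : ℂ), hρ.ofReal, fun x hx => by simp [hsupp x hx], fun w => ⟨?_, ?_, ?_⟩⟩
  · refine (VectorFourier.norm_fourierIntegral_le_integral_norm _ _ _ _ _).trans ?_
    simp only [Complex.norm_real]
    rw [← hint]
    exact (integral_congr_ae (Eventually.of_forall fun x => Real.norm_of_nonneg (hpos x))).le
  · have := hφ (ε • w)
    rw [norm_iteratedFDeriv_zero, norm_smul, Real.norm_of_nonneg hε.le, pow_one] at this
    rw [hF]
    exact this
  · exact norm_fourier_sub_one_le hρ hpos hint hsupp w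

/-- Mollification multiplies the Fourier transform and shrinks the zero set by the size of the
support of the mollifier. -/
lemma exists_mollification {f ρ : E → ℂ} (hf : Integrable f) (hρ : Integrable ρ) {ε : ℝ}
    (hsupp : ∀ x, ε < ‖x‖ → ρ x = 0) {x₀ : E} {r : ℝ} (hvan : ∀ x ∈ Metric.ball x₀ r, f x = 0) :
    ∃ f' : E → ℂ, Integrable f' ∧ (∀ w, 𝓕 f' w = 𝓕 f w * 𝓕 ρ w) ∧
      ∀ x ∈ Metric.ball x₀ (r - ε), f' x = 0 := by
  refine ⟨ρ ⋆[ContinuousLinearMap.mul ℂ ℂ] f, hρ.integrable_convolution _ hf, fun w => ?_,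
    fun x hx => ?_⟩
  · rw [Real.fourier_mul_convolution_eq hρ hf, mul_comm]
  · rw [convolution_def]
    refine integral_eq_zero_of_ae (Eventually.of_forall fun y => ?_)
    rcases lt_or_ge ε ‖y‖ with hy | hy
    · simp [hsupp y hy]
    · have : f (x - y) = 0 := by
        apply hvan
        rw [Metric.mem_ball, dist_eq_norm] at hx ⊢
        calc ‖x - y - x₀‖ = ‖(x - x₀) - y‖ := by congr 1; abel
          _ ≤ ‖x - x₀‖ + ‖y‖ := norm_sub_le _ _
          _ < r := by linarith
      simp [this]

end Fourier

lemma pow_mul_exp_neg_le {x : ℝ} (hx : 0 ≤ x) (k : ℕ) : x ^ k * Real.exp (-x) ≤ (k : ℝ) ^ k := by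
  have h := Real.pow_div_factorial_le_exp x hx k
  rw [div_le_iff₀ (by positivity)] at h
  rw [Real.exp_neg, ← div_eq_mul_inv, div_le_iff₀ (Real.exp_pos x), mul_comm]
  refine h.trans ?_
  gcongr
  exact_mod_cast Nat.factorial_le_pow k

/-- The weight `exp (-x θ(x))`, damped by a factor `p` of Gevrey type, has moments controlled by
the values of `θ` along fourth powers. -/
lemma exists_moment_bound {θ : ℝ → ℝ} (hθ_pos : ∀ t, 0 ≤ t → 0 < θ t)
    (hθ_anti : AntitoneOn θ (Ici 0)) {C : ℝ} (hC : 0 < C) {q : ℝ} (hq : 0 < q) (N : ℕ) :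
    ∃ Z : ℝ, 0 < Z ∧ ∀ x p : ℝ, 0 ≤ x → 0 ≤ p → p ≤ 1 →
      (∀ m : ℕ, x ^ m * p ≤ (q * ((m : ℝ) + 1) ^ 2) ^ m) → ∀ k : ℕ,
      x ^ (k + 1) * (1 + x) ^ N * (C * Real.exp (-x * θ x) * p) *
        (θ (((N : ℝ) + 1) ^ 4 * ((k : ℝ) + 1) ^ 4) / ((k : ℝ) + 1)) ^ (k + 1) ≤ Z ^ (k + 1) := by
  set D := (q * ((N : ℝ) + 1) ^ 2) ^ N with hD
  set R := max 1 (81 * q ^ 2) with hR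
  have hR1 : 1 ≤ R := le_max_left _ _
  have hD0 : 0 ≤ D := by positivity
  have hθ0 : 0 < θ 0 := hθ_pos 0 le_rfl
  set Z := 2 ^ N * ((C + 1) * ((1 + D) * ((1 + θ 0) * R ^ (N + 1)))) with hZ
  have h2N : (1 : ℝ) ≤ 2 ^ N := one_le_pow₀ (by norm_num)
  have hRN : 1 ≤ R ^ (N + 1) := one_le_pow₀ hR1
  refine ⟨Z, by positivity, fun x p hx hp hp1 hxp k => ?_⟩
  set n := k + 1 with hn
  have hn1 : (1 : ℝ) ≤ n := by rw [hn]; push_cast; linarith [(Nat.cast_nonneg k : (0 : ℝ) ≤ k)]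
  have hn0 : n ≠ 0 := by omega
  rw [show (k : ℝ) + 1 = n by rw [hn]; push_cast; ring]
  set T := ((N : ℝ) + 1) ^ 4 * (n : ℝ) ^ 4 with hT
  have hT0 : 0 ≤ T := by positivity
  have hη : 0 < θ T := hθ_pos T hT0
  have hη0 : θ T ≤ θ 0 := hθ_anti (mem_Ici.2 le_rfl) (mem_Ici.2 hT0) hT0
  set b := θ T / n with hb
  have hb0 : 0 < b := by positivity
  have hbθ : b ≤ 1 + θ 0 := by
    refine (div_le_self hη.le hn1).trans ?_
    linarith
  have hbn : b ^ n ≤ (1 + θ 0) ^ n := by gcongr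
  have hexp : Real.exp (-x * θ x) ≤ 1 := by
    rw [Real.exp_le_one_iff]
    nlinarith [hθ_pos x hx]
  have hCn : C ≤ (C + 1) ^ n := (by linarith : C ≤ C + 1).trans (le_self_pow₀ (by linarith) hn0)
  have h2n : (2 : ℝ) ^ N ≤ (2 ^ N) ^ n := le_self_pow₀ h2N hn0
  have hDn : D ≤ (1 + D) ^ n := (by linarith : D ≤ 1 + D).trans (le_self_pow₀ (by linarith) hn0)
  have hDn1 : 1 ≤ (1 + D) ^ n := one_le_pow₀ (by linarith)
  have hθn1 : 1 ≤ (1 + θ 0) ^ n := one_le_pow₀ (by linarith)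
  have hRn1 : 1 ≤ (R ^ (N + 1)) ^ n := one_le_pow₀ hRN
  have hZn : Z ^ n = (2 ^ N) ^ n * ((C + 1) ^ n * ((1 + D) ^ n * ((1 + θ 0) ^ n *
      (R ^ (N + 1)) ^ n))) := by
    rw [hZ]; simp only [mul_pow]
  have conclude : ∀ d t r : ℝ, 0 ≤ d → 0 ≤ t → 0 ≤ r → d ≤ (1 + D) ^ n → t ≤ (1 + θ 0) ^ n →
      r ≤ (R ^ (N + 1)) ^ n → 2 ^ N * (C * (d * (t * r))) ≤ Z ^ n := by
    intro d t r hd ht hr hd' ht' hr'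
    rw [hZn]
    gcongr
  rcases le_or_gt x 1 with hx1 | hx1
  · have h1 : x ^ n ≤ 1 := pow_le_one₀ hx hx1
    have h2 : (1 + x) ^ N ≤ 2 ^ N := by gcongr; linarith
    calc _ ≤ 1 * 2 ^ N * (C * 1 * 1) * (1 + θ 0) ^ n := by gcongr
      _ = 2 ^ N * (C * (1 * ((1 + θ 0) ^ n * 1))) := by ring
      _ ≤ _ := conclude _ _ _ zero_le_one (by positivity) zero_le_one hDn1 le_rfl hRn1
  have h2x : (1 + x) ^ N ≤ 2 ^ N * x ^ N := by
    rw [← mul_pow]; gcongr; linarith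
  rcases le_or_gt x T with hxT | hxT
  · have h1 : Real.exp (-x * θ x) ≤ Real.exp (-(x * θ T)) := by
      rw [Real.exp_le_exp]
      have := hθ_anti (mem_Ici.2 hx) (mem_Ici.2 hT0) hxT
      nlinarith
    have h2 : x ^ n * Real.exp (-(x * θ T)) * b ^ n ≤ 1 := by
      have := pow_mul_exp_neg_le (by positivity : 0 ≤ x * θ T) n
      calc _ = ((x * θ T) ^ n * Real.exp (-(x * θ T))) / (n : ℝ) ^ n := by
            rw [hb, div_pow, mul_pow]; ring
        _ ≤ 1 := by rw [div_le_one (by positivity)]; exact this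
    calc _ ≤ x ^ n * (2 ^ N * x ^ N) * (C * Real.exp (-(x * θ T)) * p) * b ^ n := by gcongr
      _ = 2 ^ N * (C * ((x ^ N * p) * (x ^ n * Real.exp (-(x * θ T)) * b ^ n))) := by ring
      _ ≤ 2 ^ N * (C * (D * 1)) := by
          gcongr
          exact hxp N
      _ = 2 ^ N * (C * (D * (1 * 1))) := by ring
      _ ≤ _ := conclude _ _ _ hD0 zero_le_one zero_le_one hDn hθn1 hRn1
  · set K := n + N with hK
    have hKn : K ≤ (N + 1) * n := by
      rw [hK]; nlinarith [Nat.one_le_iff_ne_zero.2 hn0]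
    have hK1 : (1 : ℝ) ≤ K := by
      exact_mod_cast (by omega : 1 ≤ K)
    have hKT : (K : ℝ) ^ 4 ≤ T := by
      rw [hT, ← mul_pow]
      gcongr
      exact_mod_cast hKn
    have hxK : x ^ K * p ≤ R ^ K := by
      have h1 := hxp (2 * K)
      have h3 : q * (((2 * K : ℕ) : ℝ) + 1) ^ 2 ≤ q * (3 * K) ^ 2 := by
        gcongr
        push_cast
        linarith
      have h4 : (q * (3 * (K : ℝ)) ^ 2) ^ 2 ≤ R * x := by
        calc _ = 81 * q ^ 2 * (K : ℝ) ^ 4 := by ring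
          _ ≤ R * x := by
            gcongr
            · exact le_max_right _ _
            · linarith
      have h5 : x ^ K * (x ^ K * p) ≤ x ^ K * R ^ K := by
        calc _ = x ^ (2 * K) * p := by ring
          _ ≤ _ := h1
          _ ≤ (q * (3 * (K : ℝ)) ^ 2) ^ (2 * K) := by gcongr
          _ = ((q * (3 * (K : ℝ)) ^ 2) ^ 2) ^ K := by rw [pow_mul]
          _ ≤ (R * x) ^ K := by gcongr
          _ = _ := by rw [mul_pow, mul_comm]
      exact le_of_mul_le_mul_left h5 (by positivity)
    have hRK : R ^ K ≤ (R ^ (N + 1)) ^ n := by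
      rw [← pow_mul]
      exact pow_le_pow_right₀ hR1 hKn
    calc _ ≤ x ^ n * (2 ^ N * x ^ N) * (C * 1 * p) * (1 + θ 0) ^ n := by gcongr
      _ = 2 ^ N * (C * (1 * ((1 + θ 0) ^ n * (x ^ K * p)))) := by rw [hK]; ring
      _ ≤ _ := conclude _ _ _ zero_le_one (by positivity) (by positivity) hDn1 le_rfl
          (hxK.trans hRK)

section Moments

open scoped FourierTransform

variable {E : Type*} [NormedAddCommGroup E] [InnerProductSpace ℝ E] [FiniteDimensional ℝ E]
  [MeasurableSpace E] [BorelSpace E]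

/-- Directional derivatives of an inverse Fourier integral along a line. -/
lemma hasDerivAt_integral_inner_pow_mul_exp {F : E → ℂ} (hF : AEStronglyMeasurable F)
    (hint : ∀ k : ℕ, Integrable fun ξ => ‖ξ‖ ^ k * ‖F ξ‖) (x u : E) (k : ℕ) (t : ℝ) :
    HasDerivAt
      (fun t : ℝ => ∫ ξ, ((2 * Real.pi * ⟪u, ξ⟫ : ℝ) * Complex.I) ^ k *
        Complex.exp ((2 * Real.pi * ⟪x + t • u, ξ⟫ : ℝ) * Complex.I) * F ξ)
      (∫ ξ, ((2 * Real.pi * ⟪u, ξ⟫ : ℝ) * Complex.I) ^ (k + 1) *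
        Complex.exp ((2 * Real.pi * ⟪x + t • u, ξ⟫ : ℝ) * Complex.I) * F ξ) t := by
  have hmeas : ∀ (k : ℕ) (t : ℝ), AEStronglyMeasurable (fun ξ : E =>
      ((2 * Real.pi * ⟪u, ξ⟫ : ℝ) * Complex.I) ^ k *
        Complex.exp ((2 * Real.pi * ⟪x + t • u, ξ⟫ : ℝ) * Complex.I) * F ξ) := fun k t =>
    (Continuous.aestronglyMeasurable (by fun_prop)).mul hF
  have hnorm : ∀ (k : ℕ) (t : ℝ) (ξ : E), ‖((2 * Real.pi * ⟪u, ξ⟫ : ℝ) * Complex.I) ^ k *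
      Complex.exp ((2 * Real.pi * ⟪x + t • u, ξ⟫ : ℝ) * Complex.I) * F ξ‖ ≤
      (2 * Real.pi * ‖u‖) ^ k * (‖ξ‖ ^ k * ‖F ξ‖) := by
    intro k t ξ
    rw [norm_mul, norm_mul, norm_pow, norm_mul, Complex.norm_I, mul_one, Complex.norm_real,
      Complex.norm_exp_ofReal_mul_I, mul_one, ← mul_assoc, ← mul_pow, Real.norm_eq_abs, abs_mul,
      abs_of_pos Real.two_pi_pos, mul_assoc (2 * Real.pi)]
    have := abs_real_inner_le_norm u ξ
    gcongr
  refine (hasDerivAt_integral_of_dominated_loc_of_deriv_le (s := univ) univ_mem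
    (Eventually.of_forall fun t => hmeas k t)
    (((hint k).const_mul _).mono' (hmeas k t) (Eventually.of_forall (hnorm k t)))
    (hmeas (k + 1) t) (Eventually.of_forall fun ξ t _ => hnorm (k + 1) t ξ)
    ((hint (k + 1)).const_mul _) (Eventually.of_forall fun ξ t _ => ?_)).2
  have h1 : HasDerivAt (fun t : ℝ => ((2 * Real.pi * ⟪x + t • u, ξ⟫ : ℝ) : ℂ) * Complex.I)
      ((2 * Real.pi * ⟪u, ξ⟫ : ℝ) * Complex.I) t := by
    have h2 : HasDerivAt (fun t : ℝ => 2 * Real.pi * ⟪x + t • u, ξ⟫) (2 * Real.pi * ⟪u, ξ⟫) t := by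
      simp only [inner_add_left, inner_smul_left, conj_trivial]
      simpa using (((hasDerivAt_id t).mul_const ⟪u, ξ⟫).const_add ⟪x, ξ⟫).const_mul (2 * Real.pi)
    exact h2.ofReal_comp.mul_const _
  refine ((h1.cexp.const_mul (((2 * Real.pi * ⟪u, ξ⟫ : ℝ) * Complex.I) ^ k)).mul_const
    (F ξ)).congr_deriv ?_
  ring

/-- Absolute moments are log-convex. -/
lemma integral_norm_pow_mul_sq_le {F : E → ℂ}
    (hint : ∀ k : ℕ, Integrable fun ξ => ‖ξ‖ ^ k * ‖F ξ‖) (k : ℕ) :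
    (∫ ξ, ‖ξ‖ ^ (k + 1) * ‖F ξ‖) ^ 2 ≤ (∫ ξ, ‖ξ‖ ^ k * ‖F ξ‖) * ∫ ξ, ‖ξ‖ ^ (k + 2) * ‖F ξ‖ := by
  have quad : ∀ l : ℝ, 0 ≤ (∫ ξ, ‖ξ‖ ^ k * ‖F ξ‖) * (l * l) +
      (-2 * ∫ ξ, ‖ξ‖ ^ (k + 1) * ‖F ξ‖) * l + ∫ ξ, ‖ξ‖ ^ (k + 2) * ‖F ξ‖ := by
    intro l
    have : 0 ≤ ∫ ξ, (‖ξ‖ ^ k * ‖F ξ‖ * (l * l) + ‖ξ‖ ^ (k + 1) * ‖F ξ‖ * (-2 * l)) +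
        ‖ξ‖ ^ (k + 2) * ‖F ξ‖ := by
      refine integral_nonneg fun ξ => ?_
      have : (‖ξ‖ ^ k * ‖F ξ‖ * (l * l) + ‖ξ‖ ^ (k + 1) * ‖F ξ‖ * (-2 * l)) +
          ‖ξ‖ ^ (k + 2) * ‖F ξ‖ = ‖ξ‖ ^ k * ‖F ξ‖ * (‖ξ‖ - l) ^ 2 := by ring
      simp only [this, Pi.zero_apply]
      positivity
    have hi : Integrable fun ξ =>
        ‖ξ‖ ^ k * ‖F ξ‖ * (l * l) + ‖ξ‖ ^ (k + 1) * ‖F ξ‖ * (-2 * l) :=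
      ((hint k).mul_const _).add ((hint (k + 1)).mul_const _)
    rw [integral_add hi (hint (k + 2)),
      integral_add ((hint k).mul_const _) ((hint (k + 1)).mul_const _),
      integral_mul_const, integral_mul_const] at this
    linarith
  have := discrim_le_zero quad
  rw [discrim] at this
  linarith

/-- **Quasi-analyticity**: if the moments of `F` satisfy the Denjoy–Carleman condition and the
inverse Fourier transform of `F` vanishes on a ball, then `F = 0`. -/
lemma ae_eq_zero_of_fourierInv_eq_zero_on_ball [Nontrivial E] {F : E → ℂ}
    (hF : AEStronglyMeasurable F) (hint : ∀ k : ℕ, Integrable fun ξ => ‖ξ‖ ^ k * ‖F ξ‖)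
    {b : ℕ → ℝ} (hb : ∀ k, 0 ≤ b k) (hdiv : ¬ Summable b) {Z : ℝ} (hZ : 0 < Z)
    (hbZ : ∀ k, (∫ ξ, ‖ξ‖ ^ (k + 1) * ‖F ξ‖) * b k ^ (k + 1) ≤ Z ^ (k + 1))
    {x₀ : E} {r : ℝ} (hr : 0 < r) (hvan : ∀ x ∈ Metric.ball x₀ r, 𝓕⁻ F x = 0) :
    ∀ᵐ ξ, F ξ = 0 := by
  by_contra hne
  have hFi : Integrable F := by
    refine (integrable_norm_iff hF).1 ((hint 0).congr (Eventually.of_forall fun ξ => ?_))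
    simp
  apply hne
  have hmom : ∀ k : ℕ, 0 < ∫ ξ, ‖ξ‖ ^ k * ‖F ξ‖ := by
    intro k
    refine lt_of_le_of_ne (integral_nonneg fun ξ => by positivity) fun h => hne ?_
    have h0 := (integral_eq_zero_iff_of_nonneg (fun ξ => by positivity) (hint k)).1 h.symm
    have hξ : ∀ᵐ ξ : E, ξ ≠ 0 := by
      rw [ae_iff]; simp
    filter_upwards [h0, hξ] with ξ h1 h2
    have h3 : ‖ξ‖ ^ k ≠ 0 := pow_ne_zero _ (norm_ne_zero_iff.2 h2)
    simpa [h3, h2] using h1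
  have hzero : ∀ x, 𝓕⁻ F x = 0 := by
    intro x
    set u := x - x₀ with hu
    let g : ℕ → ℝ → ℂ := fun k t => ∫ ξ, ((2 * Real.pi * ⟪u, ξ⟫ : ℝ) * Complex.I) ^ k *
        Complex.exp ((2 * Real.pi * ⟪x₀ + t • u, ξ⟫ : ℝ) * Complex.I) * F ξ
    have hg : ∀ k t, HasDerivAt (g k) (g (k + 1) t) t := fun k t =>
      hasDerivAt_integral_inner_pow_mul_exp hF hint x₀ u k t
    have hg0 : ∀ t, g 0 t = 𝓕⁻ F (x₀ + t • u) := by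
      intro t
      rw [Real.fourierInv_eq']
      simp only [g, pow_zero, one_mul, smul_eq_mul, real_inner_comm]
    set L := 2 * Real.pi * ‖u‖ + 1 with hL
    have hL0 : 0 < L := by positivity
    have hbd : ∀ k t, ‖g k t‖ ≤ L ^ k * ∫ ξ, ‖ξ‖ ^ k * ‖F ξ‖ := by
      intro k t
      rw [← integral_const_mul]
      refine norm_integral_le_of_norm_le ((hint k).const_mul _) (Eventually.of_forall fun ξ => ?_)
      rw [norm_mul, norm_mul, norm_pow, norm_mul, Complex.norm_I, mul_one, Complex.norm_real,
        Complex.norm_exp_ofReal_mul_I, mul_one, ← mul_assoc, ← mul_pow, Real.norm_eq_abs, abs_mul,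
        abs_of_pos Real.two_pi_pos]
      have h1 : 2 * Real.pi * |⟪u, ξ⟫| ≤ L * ‖ξ‖ := by
        calc _ ≤ 2 * Real.pi * (‖u‖ * ‖ξ‖) := by
              have := abs_real_inner_le_norm u ξ
              gcongr
          _ = (2 * Real.pi * ‖u‖) * ‖ξ‖ := by ring
          _ ≤ L * ‖ξ‖ := by gcongr; linarith
      gcongr
    have hnear : ∃ δ > 0, ∀ k, ∀ t ∈ Ioo (-δ) δ, g k t = 0 := by
      refine ⟨r / (‖u‖ + 1), by positivity, fun k => ?_⟩
      induction k with
      | zero =>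
        intro t ht
        rw [hg0]
        apply hvan
        rw [Metric.mem_ball, dist_eq_norm, add_sub_cancel_left, norm_smul, Real.norm_eq_abs]
        have h1 : |t| < r / (‖u‖ + 1) := abs_lt.2 ht
        rw [lt_div_iff₀ (by positivity)] at h1
        nlinarith [abs_nonneg t]
      | succ k ih =>
        intro t ht
        have h1 : g k =ᶠ[nhds t] fun _ => 0 := by
          filter_upwards [Ioo_mem_nhds ht.1 ht.2] with s hs using ih s hs
        exact (hg k t).unique ((hasDerivAt_const t (0 : ℂ)).congr_of_eventuallyEq h1)
    obtain ⟨δ, hδ, hnear⟩ := hnear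
    set η := min 1 (∫ ξ, ‖ξ‖ ^ 0 * ‖F ξ‖) / (L * Z) with hη
    have hmin : 0 < min 1 (∫ ξ, ‖ξ‖ ^ 0 * ‖F ξ‖) := lt_min one_pos (hmom 0)
    have hη0 : 0 < η := by positivity
    have := eq_zero_of_denjoy_carleman (g := g) (M := fun k => L ^ k * ∫ ξ, ‖ξ‖ ^ k * ‖F ξ‖)
      (b := fun k => η * b k) (fun k => mul_pos (pow_pos hL0 k) (hmom k)) (fun k => ?_) hg hbd
      (fun k => mul_nonneg hη0.le (hb k)) (fun k => ?_) (fun h => hdiv ?_)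
      (fun k => hnear k 0 ⟨by linarith, hδ⟩) zero_le_one
    · rw [hg0, one_smul, hu, add_sub_cancel] at this
      exact this
    · calc _ = L ^ (2 * k + 2) * (∫ ξ, ‖ξ‖ ^ (k + 1) * ‖F ξ‖) ^ 2 := by ring
        _ ≤ L ^ (2 * k + 2) * ((∫ ξ, ‖ξ‖ ^ k * ‖F ξ‖) * ∫ ξ, ‖ξ‖ ^ (k + 2) * ‖F ξ‖) := by
          gcongr
          exact integral_norm_pow_mul_sq_le hint k
        _ = _ := by ring
    · calc _ = (L * η) ^ (k + 1) * ((∫ ξ, ‖ξ‖ ^ (k + 1) * ‖F ξ‖) * b k ^ (k + 1)) := by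
            rw [mul_pow, mul_pow]; ring
        _ ≤ (L * η) ^ (k + 1) * Z ^ (k + 1) := by
            gcongr
            exact hbZ k
        _ = (min 1 (∫ ξ, ‖ξ‖ ^ 0 * ‖F ξ‖)) ^ (k + 1) := by
            rw [← mul_pow, hη]; congr 1; field_simp
        _ ≤ min 1 (∫ ξ, ‖ξ‖ ^ 0 * ‖F ξ‖) :=
            pow_le_of_le_one hmin.le (min_le_left _ _) (by omega)
        _ ≤ _ := by
            rw [pow_zero L, one_mul]
            exact min_le_right _ _
    · exact (summable_mul_left_iff hη0.ne').1 h
  refine ae_eq_zero_of_fourier_eq_zero hFi fun w => ?_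
  have := hzero (-w)
  rwa [Real.fourierInv_eq_fourier_neg, neg_neg] at this

end Moments

lemma sum_div_mul_succ (ε : ℝ) (K : ℕ) :
    ∑ j ∈ Finset.range K, ε / (((j : ℝ) + 1) * (j + 2)) = ε - ε / (K + 1) := by
  induction K with
  | zero => simp
  | succ K ih =>
    rw [Finset.sum_range_succ, ih]
    push_cast
    field_simp
    ring

lemma sum_div_mul_succ_le {ε : ℝ} (hε : 0 ≤ ε) (K : ℕ) :
    ∑ j ∈ Finset.range K, ε / (((j : ℝ) + 1) * (j + 2)) ≤ ε := by
  rw [sum_div_mul_succ]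
  exact sub_le_self _ (by positivity)

section Products

variable {a : ℕ → ℂ}

lemma norm_prod_range_le_one (h1 : ∀ j, ‖a j‖ ≤ 1) (K : ℕ) :
    ‖∏ j ∈ Finset.range K, a j‖ ≤ 1 := by
  rw [norm_prod]
  exact Finset.prod_le_one (fun j _ => norm_nonneg _) fun j _ => h1 j

lemma norm_prod_range_succ_sub_le (h1 : ∀ j, ‖a j‖ ≤ 1) (K : ℕ) :
    ‖∏ j ∈ Finset.range (K + 1), a j - ∏ j ∈ Finset.range K, a j‖ ≤ ‖a K - 1‖ := by
  rw [Finset.prod_range_succ, ← mul_sub_one, norm_mul]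
  exact mul_le_of_le_one_left (norm_nonneg _) (norm_prod_range_le_one h1 K)

lemma norm_prod_range_sub_one_le (h1 : ∀ j, ‖a j‖ ≤ 1) (K : ℕ) :
    ‖∏ j ∈ Finset.range K, a j - 1‖ ≤ ∑ j ∈ Finset.range K, ‖a j - 1‖ := by
  induction K with
  | zero => simp
  | succ K ih =>
    rw [Finset.sum_range_succ, ← sub_add_sub_cancel' (∏ j ∈ Finset.range K, a j) 1]
    exact (norm_add_le _ _).trans (add_le_add ih (norm_prod_range_succ_sub_le h1 K))

lemma exists_tendsto_prod_range (h1 : ∀ j, ‖a j‖ ≤ 1) (hs : Summable fun j => ‖a j - 1‖) :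
    ∃ p, Tendsto (fun K => ∏ j ∈ Finset.range K, a j) atTop (nhds p) := by
  refine cauchySeq_tendsto_of_complete (cauchySeq_of_summable_dist ?_)
  refine hs.of_nonneg_of_le (fun _ => dist_nonneg) fun K => ?_
  rw [dist_comm, dist_eq_norm]
  exact norm_prod_range_succ_sub_le h1 K

lemma pow_mul_norm_prod_range_le {x ε c : ℝ} (hx : 0 ≤ x) (hε : 0 < ε) (hc : 0 ≤ c)
    (h1 : ∀ j, ‖a j‖ ≤ 1) (h2 : ∀ j : ℕ, ε / (((j : ℝ) + 1) * (j + 2)) * x * ‖a j‖ ≤ c)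
    {m K : ℕ} (hmK : m ≤ K) :
    x ^ m * ‖∏ j ∈ Finset.range K, a j‖ ≤ (c / ε * ((m : ℝ) + 1) ^ 2) ^ m := by
  rw [← Finset.prod_range_mul_prod_Ico _ hmK, norm_mul, norm_prod, norm_prod, ← mul_assoc]
  have h3 : ∏ j ∈ Finset.Ico m K, ‖a j‖ ≤ 1 :=
    Finset.prod_le_one (fun j _ => norm_nonneg _) fun j _ => h1 j
  refine (mul_le_of_le_one_right (by positivity) h3).trans ?_
  have h4 : x ^ m = ∏ _j ∈ Finset.range m, x := by simp
  have h5 : (c / ε * ((m : ℝ) + 1) ^ 2) ^ m =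
      ∏ _j ∈ Finset.range m, (c / ε * ((m : ℝ) + 1) ^ 2) := by simp
  rw [h4, h5, ← Finset.prod_mul_distrib]
  refine Finset.prod_le_prod (fun j _ => by positivity) fun j hj => ?_
  have hjm : (j : ℝ) + 1 ≤ m := by exact_mod_cast Finset.mem_range.1 hj
  have h6 := h2 j
  rw [mul_assoc, div_mul_eq_mul_div, div_le_iff₀ (by positivity)] at h6
  have h7 : ((j : ℝ) + 1) * (j + 2) ≤ ((m : ℝ) + 1) ^ 2 := by
    nlinarith [(Nat.cast_nonneg j : (0 : ℝ) ≤ j)]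
  rw [div_mul_eq_mul_div, le_div_iff₀ hε, mul_comm]
  exact h6.trans (by gcongr)

end Products

section Ingham

open scoped FourierTransform

variable {E : Type*} [NormedAddCommGroup E] [InnerProductSpace ℝ E] [FiniteDimensional ℝ E]
  [MeasurableSpace E] [BorelSpace E]

lemma continuous_fourier {f : E → ℂ} (hf : Integrable f) : Continuous (𝓕 f) :=
  VectorFourier.fourierIntegral_continuous Real.continuous_fourierChar continuous_inner hf

/-- Repeated mollification. -/
lemma exists_iterated_mollification {f : E → ℂ} (hf : Integrable f) {x₀ : E} {r : ℝ}
    (hvan : ∀ x ∈ Metric.ball x₀ r, f x = 0) {ρ : ℕ → E → ℂ} {ε : ℕ → ℝ}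
    (hρ : ∀ j, Integrable (ρ j)) (hsupp : ∀ j x, ε j < ‖x‖ → ρ j x = 0) (K : ℕ) :
    ∃ f' : E → ℂ, Integrable f' ∧ (∀ w, 𝓕 f' w = 𝓕 f w * ∏ j ∈ Finset.range K, 𝓕 (ρ j) w) ∧
      ∀ x ∈ Metric.ball x₀ (r - ∑ j ∈ Finset.range K, ε j), f' x = 0 := by
  induction K with
  | zero => exact ⟨f, hf, by simp, by simpa using hvan⟩
  | succ K ih =>
    obtain ⟨f₁, hf₁, hF₁, hv₁⟩ := ih
    obtain ⟨f₂, hf₂, hF₂, hv₂⟩ := exists_mollification hf₁ (hρ K) (hsupp K) hv₁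
    refine ⟨f₂, hf₂, fun w => ?_, ?_⟩
    · rw [hF₂, hF₁, Finset.prod_range_succ, mul_assoc]
    · rwa [Finset.sum_range_succ, ← sub_sub]

lemma integrable_one_add_norm_pow_inv :
    Integrable fun x : E => ((1 + ‖x‖) ^ (Module.finrank ℝ E + 1))⁻¹ := by
  refine (integrable_one_add_norm (E := E) (μ := volume)
    (r := (Module.finrank ℝ E + 1 : ℕ)) (by push_cast; linarith)).congr
    (Eventually.of_forall fun x => ?_)
  simp only
  rw [Real.rpow_neg (by positivity), Real.rpow_natCast]

/-- If `f` vanishes on a ball of radius `r` and `𝓕 f` decays as in Ingham's theorem, then `𝓕 f`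
vanishes near the origin: mollify `f` at total scale `ε < r` and apply quasi-analyticity. -/
lemma fourier_eq_zero_on_ball [Nontrivial E] {θ : ℝ → ℝ} (hθ_pos : ∀ t, 0 ≤ t → 0 < θ t)
    (hθ_anti : AntitoneOn θ (Ici 0))
    (hθ_div : ∀ A : ℝ, 1 ≤ A →
      ¬ Summable fun k : ℕ => θ (A * ((k : ℝ) + 1) ^ 4) / ((k : ℝ) + 1))
    {f : E → ℂ} (hf : Integrable f) {x₀ : E} {r : ℝ} (hvan : ∀ x ∈ Metric.ball x₀ r, f x = 0)
    {C : ℝ} (hC : 0 < C) (hdecay : ∀ w, ‖𝓕 f w‖ ≤ C * Real.exp (-‖w‖ * θ ‖w‖))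
    {ε : ℝ} (hε : 0 < ε) (hεr : ε < r) :
    ∀ᵐ w, 2 * Real.pi * ε * ‖w‖ < 1 → 𝓕 f w = 0 := by
  obtain ⟨c, hc, hmoll⟩ := exists_mollifier_s19 E
  have hεj : ∀ j : ℕ, 0 < ε / (((j : ℝ) + 1) * (j + 2)) := fun j => by positivity
  choose ρ hρ hsupp hF1 hF2 hF3 using fun j : ℕ => hmoll _ (hεj j)
  have hsum : ∀ w, Summable fun j => ‖𝓕 (ρ j) w - 1‖ := by
    intro w
    refine Summable.of_nonneg_of_le (fun _ => norm_nonneg _) (fun j => hF3 j w) ?_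
    refine Summable.mul_right _ (Summable.mul_left _ ?_)
    exact summable_of_sum_range_le (fun j => (hεj j).le) (sum_div_mul_succ_le hε.le)
  choose P hP using fun w => exists_tendsto_prod_range (fun j => hF1 j w) (hsum w)
  have hPbd : ∀ (m : ℕ) (w : E), ‖w‖ ^ m * ‖P w‖ ≤ (c / ε * ((m : ℝ) + 1) ^ 2) ^ m := by
    intro m w
    refine le_of_tendsto ((hP w).norm.const_mul _) ?_
    filter_upwards [eventually_ge_atTop m] with K hK
    exact pow_mul_norm_prod_range_le (norm_nonneg w) hε hc.le (fun j => hF1 j w)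
      (fun j => hF2 j w) hK
  have hP1 : ∀ w, ‖P w‖ ≤ 1 := fun w =>
    le_of_tendsto' (hP w).norm fun K => norm_prod_range_le_one (fun j => hF1 j w) K
  have hPsub : ∀ w, ‖P w - 1‖ ≤ 2 * Real.pi * ε * ‖w‖ := by
    intro w
    refine le_of_tendsto' ((hP w).sub_const 1).norm fun K => ?_
    refine (norm_prod_range_sub_one_le (fun j => hF1 j w) K).trans ?_
    refine (Finset.sum_le_sum fun j _ => hF3 j w).trans ?_
    rw [← Finset.sum_mul, ← Finset.mul_sum]
    have := sum_div_mul_succ_le hε.le K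
    gcongr
  have hfc := continuous_fourier hf
  have hprodc : ∀ K, Continuous fun w => 𝓕 f w * ∏ j ∈ Finset.range K, 𝓕 (ρ j) w := fun K =>
    hfc.mul (continuous_finsetProd _ fun j _ => continuous_fourier (hρ j))
  have hlim : ∀ w, Tendsto (fun K => 𝓕 f w * ∏ j ∈ Finset.range K, 𝓕 (ρ j) w) atTop
      (nhds (𝓕 f w * P w)) := fun w => (hP w).const_mul _
  have hmeas : AEStronglyMeasurable (fun w => 𝓕 f w * P w) :=
    aestronglyMeasurable_of_tendsto_ae atTop (fun K => (hprodc K).aestronglyMeasurable)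
      (Eventually.of_forall hlim)
  set N := Module.finrank ℝ E + 1 with hN
  have hJ := integrable_one_add_norm_pow_inv (E := E)
  have hfC : ∀ w, ‖𝓕 f w‖ ≤ C := fun w => (hdecay w).trans <| mul_le_of_le_one_right hC.le <| by
    rw [Real.exp_le_one_iff]
    nlinarith [hθ_pos ‖w‖ (norm_nonneg w), norm_nonneg w]
  have hdom : ∀ K, N ≤ K → ∀ w, ‖𝓕 f w * ∏ j ∈ Finset.range K, 𝓕 (ρ j) w‖ ≤
      C * (2 ^ N * (1 + (c / ε * ((N : ℝ) + 1) ^ 2) ^ N)) * ((1 + ‖w‖) ^ N)⁻¹ := by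
    intro K hK w
    rw [norm_mul, mul_assoc]
    refine mul_le_mul (hfC w) ?_ (norm_nonneg _) hC.le
    rw [← div_eq_mul_inv, le_div_iff₀ (by positivity)]
    have h1 := pow_mul_norm_prod_range_le (norm_nonneg w) hε hc.le (fun j => hF1 j w)
      (fun j => hF2 j w) hK
    have h2 := norm_prod_range_le_one (fun j => hF1 j w) K
    rcases le_or_gt ‖w‖ 1 with hw | hw
    · have h3 : (1 + ‖w‖) ^ N ≤ 2 ^ N := by gcongr; linarith
      calc _ ≤ 1 * (2 : ℝ) ^ N := by gcongr
        _ = 2 ^ N * 1 := by ring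
        _ ≤ _ := by
          gcongr
          exact le_add_of_nonneg_right (by positivity)
    · have h3 : (1 + ‖w‖) ^ N ≤ 2 ^ N * ‖w‖ ^ N := by
        rw [← mul_pow]; gcongr; linarith
      calc _ ≤ ‖∏ j ∈ Finset.range K, 𝓕 (ρ j) w‖ * (2 ^ N * ‖w‖ ^ N) := by gcongr
        _ = 2 ^ N * (‖w‖ ^ N * ‖∏ j ∈ Finset.range K, 𝓕 (ρ j) w‖) := by ring
        _ ≤ _ := by
          gcongr
          linarith
  have hvanP : ∀ x ∈ Metric.ball x₀ (r - ε), 𝓕⁻ (fun w => 𝓕 f w * P w) x = 0 := by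
    intro x hx
    have hK0 : ∀ K, N ≤ K → 𝓕⁻ (fun w => 𝓕 f w * ∏ j ∈ Finset.range K, 𝓕 (ρ j) w) x = 0 := by
      intro K hK
      obtain ⟨f', hf', hF', hv'⟩ := exists_iterated_mollification hf hvan hρ hsupp K
      have hF'eq : 𝓕 f' = fun w => 𝓕 f w * ∏ j ∈ Finset.range K, 𝓕 (ρ j) w := funext hF'
      have hx' : x ∈ Metric.ball x₀ (r - ∑ j ∈ Finset.range K, ε / (((j : ℝ) + 1) * (j + 2))) :=
        Metric.ball_subset_ball (by linarith [sum_div_mul_succ_le hε.le K]) hx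
      rw [← hF'eq, hf'.fourierInv_fourier_eq, hv' x hx']
      · rw [hF'eq]
        exact (hJ.const_mul _).mono' (hprodc K).aestronglyMeasurable
          (Eventually.of_forall (hdom K hK))
      · refine (continuousAt_const (y := (0 : ℂ))).congr ?_
        filter_upwards [Metric.isOpen_ball.mem_nhds hx'] with y hy using (hv' y hy).symm
    have hconv : Tendsto
        (fun K => 𝓕⁻ (fun w => 𝓕 f w * ∏ j ∈ Finset.range K, 𝓕 (ρ j) w) x) atTop
        (nhds (𝓕⁻ (fun w => 𝓕 f w * P w) x)) := by
      simp only [Real.fourierInv_eq']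
      refine tendsto_integral_filter_of_dominated_convergence
        (fun w => C * (2 ^ N * (1 + (c / ε * ((N : ℝ) + 1) ^ 2) ^ N)) * ((1 + ‖w‖) ^ N)⁻¹)
        (Eventually.of_forall fun K => Continuous.aestronglyMeasurable (by
          have := hprodc K
          fun_prop)) ?_ (hJ.const_mul _)
        (Eventually.of_forall fun w => (hlim w).const_smul _)
      filter_upwards [eventually_ge_atTop N] with K hK
      refine Eventually.of_forall fun w => ?_
      rw [norm_smul, Complex.norm_exp_ofReal_mul_I, one_mul]
      exact hdom K hK w
    refine tendsto_nhds_unique hconv (tendsto_const_nhds.congr' ?_)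
    filter_upwards [eventually_ge_atTop N] with K hK using (hK0 K hK).symm
  obtain ⟨Z, hZ, hmom⟩ := exists_moment_bound hθ_pos hθ_anti hC (div_pos hc hε) N
  set b : ℕ → ℝ := fun k => θ (((N : ℝ) + 1) ^ 4 * ((k : ℝ) + 1) ^ 4) / ((k : ℝ) + 1) with hb
  have hb0 : ∀ k, 0 < b k := fun k => div_pos (hθ_pos _ (by positivity)) (by positivity)
  have hpt : ∀ k w, ‖w‖ ^ (k + 1) * ‖𝓕 f w * P w‖ ≤
      Z ^ (k + 1) / b k ^ (k + 1) * ((1 + ‖w‖) ^ N)⁻¹ := by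
    intro k w
    have h1 := hmom ‖w‖ ‖P w‖ (norm_nonneg _) (norm_nonneg _) (hP1 w) (fun m => hPbd m w) k
    rw [← div_eq_mul_inv, div_div, le_div_iff₀ (mul_pos (pow_pos (hb0 k) _) (by positivity)),
      norm_mul]
    refine le_trans ?_ h1
    calc _ = ‖w‖ ^ (k + 1) * (1 + ‖w‖) ^ N * (‖𝓕 f w‖ * ‖P w‖) * b k ^ (k + 1) := by ring
      _ ≤ _ := by
        have := (hb0 k).le
        gcongr
        exact hdecay w
  have hint : ∀ k : ℕ, Integrable fun w => ‖w‖ ^ k * ‖𝓕 f w * P w‖ := by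
    intro k
    have hm : AEStronglyMeasurable fun w : E => ‖w‖ ^ k * ‖𝓕 f w * P w‖ :=
      (Continuous.aestronglyMeasurable (by fun_prop)).mul hmeas.norm
    rcases k with _ | k
    · refine (hJ.const_mul (C * (2 ^ N * (1 + (c / ε * ((N : ℝ) + 1) ^ 2) ^ N)))).mono' hm
        (Eventually.of_forall fun w => ?_)
      rw [pow_zero, one_mul, norm_norm]
      refine le_of_tendsto (hlim w).norm ?_
      filter_upwards [eventually_ge_atTop N] with K hK using hdom K hK w
    · refine (hJ.const_mul (Z ^ (k + 1) / b k ^ (k + 1))).mono' hm (Eventually.of_forall fun w => ?_)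
      rw [Real.norm_of_nonneg (by positivity)]
      exact hpt k w
  set J := ∫ w : E, ((1 + ‖w‖) ^ N)⁻¹ with hJdef
  have hJ0 : 0 ≤ J := integral_nonneg fun w => by positivity
  have hzero : ∀ᵐ w, 𝓕 f w * P w = 0 := by
    refine ae_eq_zero_of_fourierInv_eq_zero_on_ball hmeas hint (fun k => (hb0 k).le)
      (hθ_div _ (one_le_pow₀ (by linarith [(Nat.cast_nonneg N : (0 : ℝ) ≤ N)])))
      (Z := Z * (1 + J)) (by positivity) (fun k => ?_) (sub_pos.2 hεr) hvanP
    have h1 : ∫ w, ‖w‖ ^ (k + 1) * ‖𝓕 f w * P w‖ ≤ Z ^ (k + 1) / b k ^ (k + 1) * J := by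
      rw [hJdef, ← integral_const_mul]
      exact integral_mono (hint (k + 1)) (hJ.const_mul _) (hpt k)
    have hbk := pow_pos (hb0 k) (k + 1)
    calc _ ≤ Z ^ (k + 1) / b k ^ (k + 1) * J * b k ^ (k + 1) := by gcongr
      _ = Z ^ (k + 1) * J := by field_simp
      _ ≤ Z ^ (k + 1) * (1 + J) ^ (k + 1) := by
        gcongr
        exact (by linarith : J ≤ 1 + J).trans (le_self_pow₀ (by linarith) (by omega))
      _ = _ := (mul_pow _ _ _).symm
  filter_upwards [hzero] with w hw hwε
  refine (mul_eq_zero.1 hw).resolve_right fun h => ?_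
  have := hPsub w
  rw [h, zero_sub, norm_neg, norm_one] at this
  linarith

/-- **Ingham's theorem** for the Fourier transform normalised with `exp (-2 * π * I * ⟪x, w⟫)`. -/
lemma ae_eq_zero_of_fourier_decay [Nontrivial E] {θ : ℝ → ℝ} (hθ_pos : ∀ t, 0 ≤ t → 0 < θ t)
    (hθ_anti : AntitoneOn θ (Ici 0))
    (hθ_div : ∀ A : ℝ, 1 ≤ A →
      ¬ Summable fun k : ℕ => θ (A * ((k : ℝ) + 1) ^ 4) / ((k : ℝ) + 1))
    {f : E → ℂ} (hf : Integrable f) {x₀ : E} {r : ℝ} (hr : 0 < r)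
    (hvan : ∀ x ∈ Metric.ball x₀ r, f x = 0)
    {C : ℝ} (hC : 0 < C) (hdecay : ∀ w, ‖𝓕 f w‖ ≤ C * Real.exp (-‖w‖ * θ ‖w‖)) :
    ∀ᵐ x, f x = 0 := by
  have hae : ∀ᵐ w, 𝓕 f w = 0 := by
    have h : ∀ᵐ w, ∀ n : ℕ, 2 * Real.pi * (r / (n + 2)) * ‖w‖ < 1 → 𝓕 f w = 0 :=
      ae_all_iff.2 fun n => fourier_eq_zero_on_ball hθ_pos hθ_anti hθ_div hf hvan hC hdecay
        (by positivity) (div_lt_self hr (by linarith [(Nat.cast_nonneg n : (0 : ℝ) ≤ n)]))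
    filter_upwards [h] with w hw
    obtain ⟨n, hn⟩ := exists_nat_gt (2 * Real.pi * r * ‖w‖)
    refine hw n ?_
    rw [mul_div_assoc', div_mul_eq_mul_div, div_lt_one (by positivity)]
    linarith
  have hcont := continuous_fourier hf
  have h0 : 𝓕 f = fun _ => 0 := Continuous.ae_eq_iff_eq volume hcont continuous_const |>.1 hae
  exact ae_eq_zero_of_fourier_eq_zero hf fun w => congrFun h0 w

end Ingham

lemma norm_fourierHat {n : ℕ} (f : EuclideanSpace ℝ (Fin n) → ℂ) (w : EuclideanSpace ℝ (Fin n)) :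
    ‖fourierHat f ((2 * Real.pi) • w)‖ =
      (2 * Real.pi) ^ (-(n : ℝ) / 2) * ‖FourierTransform.fourier f w‖ := by
  rw [fourierHat, norm_mul, Complex.norm_real,
    Real.norm_of_nonneg (Real.rpow_nonneg Real.two_pi_pos.le _), Real.fourier_eq']
  congr 3
  ext x
  rw [smul_eq_mul, mul_comm, inner_smul_right]
  congr 2
  push_cast
  ring

theorem stmt_19 {n : ℕ} (hn : 1 ≤ n)
    (θ : ℝ → ℝ)
    (hθ_pos : ∀ t : ℝ, 0 ≤ t → 0 < θ t)
    (hθ_anti : AntitoneOn θ (Ici 0))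
    (hθ_lim : Tendsto θ atTop (nhds 0))
    (hθ_div : ¬ IntegrableOn (fun t : ℝ => θ t / t) (Ici 1))
    (f : EuclideanSpace ℝ (Fin n) → ℂ) (hf : Integrable f)
    (V : Set (EuclideanSpace ℝ (Fin n))) (hV_open : IsOpen V) (hV_ne : V.Nonempty)
    (hvanish : ∀ x ∈ V, f x = 0)
    (C : ℝ) (hC : 0 < C)
    (hdecay : ∀ ξ : EuclideanSpace ℝ (Fin n),
      ‖fourierHat f ξ‖ ≤ C * Real.exp (-‖ξ‖ * θ ‖ξ‖)) :
    ∀ᵐ x : EuclideanSpace ℝ (Fin n), f x = 0 := by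
  have : Nontrivial (EuclideanSpace ℝ (Fin n)) := by
    have : Nonempty (Fin n) := ⟨⟨0, hn⟩⟩
    infer_instance
  obtain ⟨x₀, hx₀⟩ := hV_ne
  obtain ⟨r, hr, hball⟩ := Metric.isOpen_iff.1 hV_open x₀ hx₀
  have hpi : 1 ≤ 2 * Real.pi := by linarith [Real.pi_gt_three]
  have hκ : 0 < (2 * Real.pi) ^ (-(n : ℝ) / 2) := Real.rpow_pos_of_pos Real.two_pi_pos _
  refine ae_eq_zero_of_fourier_decay (θ := fun t => θ (2 * Real.pi * t))
    (fun t ht => hθ_pos _ (by positivity)) (fun s hs t ht hst => ?_) (fun A hA => ?_) hf hr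
    (fun x hx => hvanish x (hball hx)) (div_pos hC hκ) fun w => ?_
  · have hs0 : 0 ≤ s := hs
    have ht0 : 0 ≤ t := ht
    exact hθ_anti (mem_Ici.2 (by positivity)) (mem_Ici.2 (by positivity)) (by gcongr)
  · simpa only [mul_assoc] using not_summable_of_not_integrableOn_div hθ_pos hθ_anti hθ_div
      (one_le_mul_of_one_le_of_one_le hpi hA)
  · have h := hdecay ((2 * Real.pi) • w)
    rw [norm_fourierHat, norm_smul, Real.norm_of_nonneg Real.two_pi_pos.le] at h
    rw [div_mul_eq_mul_div, le_div_iff₀ hκ, mul_comm]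
    refine h.trans ?_
    have := hθ_pos (2 * Real.pi * ‖w‖) (by positivity)
    gcongr
    nlinarith [norm_nonneg w]
end
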